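/- arXiv:2412.01544 — 7 statements merged into one kernel-verified Lean document; each statement's English description precedes it below -/
import Mathlib

section
/- Fix r₀ ∈ (0, 1/10] and r₁ ∈ (r₀, 1) with r₁³ ≥ 4/5, and set δ = min{1/10, (1/r₁ - 1)/2}. Then δ > 0 and for every ρ ∈ D one has U_ρ(r₀) ≤ -1 - δ. -/
open MeasureTheory Real

noncomputable section

/-- The set `D`: nonnegative, measurable, nonincreasing on `(0,1]`,
vanishing for `r > 1`, with mass one. -/
def memD (ρ : ℝ → ℝ) : Prop :=
  Measurable ρ ∧ (∀ r : ℝ, 0 ≤ ρ r) ∧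
  (∀ r s : ℝ, 0 < r → r ≤ s → s ≤ 1 → ρ s ≤ ρ r) ∧
  (∀ r : ℝ, 1 < r → ρ r = 0) ∧
  4 * π * (∫ r in (0:ℝ)..1, r ^ 2 * ρ r) = 1

/-- The gravitational potential induced by the spherically symmetric density `ρ`. -/
def U (ρ : ℝ → ℝ) (r : ℝ) : ℝ :=
  -(4 * π / r) * (∫ s in (0:ℝ)..r, s ^ 2 * ρ s) - 4 * π * (∫ s in r..1, s * ρ s)

/-- For `r₀ ∈ (0,1/10]`, `r₁ ∈ (r₀,1)` with `r₁³ ≥ 4/5` and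
`δ = min {1/10, (1/r₁ - 1)/2}`, one has `δ > 0` and `U_ρ(r₀) ≤ -1 - δ`
for every `ρ ∈ D`. -/
theorem stmt_1 (r₀ r₁ : ℝ) (hr₀ : 0 < r₀) (hr₀' : r₀ ≤ 1/10)
    (hr₁ : r₀ < r₁) (hr₁' : r₁ < 1) (hr₁'' : 4/5 ≤ r₁ ^ 3)
    (δ : ℝ) (hδ : δ = min (1/10) ((1/r₁ - 1)/2)) :
    0 < δ ∧ ∀ ρ : ℝ → ℝ, memD ρ → U ρ r₀ ≤ -1 - δ := by
  have hr1 : 0 < r₁ := hr₀.trans hr₁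
  have h1 : 1 < 1 / r₁ := by rw [lt_div_iff₀ hr1]; linarith
  have hδ1 : δ ≤ 1/10 := by rw [hδ]; exact min_le_left _ _
  refine ⟨by rw [hδ]; exact lt_min (by norm_num) (by linarith), ?_⟩
  rintro ρ ⟨-, hpos, hanti, -, hmass⟩
  have hle : r₀ ≤ 1 := by linarith
  have hI : IntervalIntegrable (fun r => r ^ 2 * ρ r) volume 0 1 := by
    by_contra h
    rw [intervalIntegral.integral_undef h] at hmass
    norm_num at hmass
  have hI1 : IntervalIntegrable (fun r => r ^ 2 * ρ r) volume 0 r₀ :=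
    hI.mono_set (by rw [Set.uIcc_of_le hr₀.le, Set.uIcc_of_le zero_le_one]
                    exact Set.Icc_subset_Icc le_rfl hle)
  have hρ : IntervalIntegrable ρ volume r₀ 1 := by
    apply AntitoneOn.intervalIntegrable
    rw [Set.uIcc_of_le hle]
    intro x hx y hy hxy
    exact hanti x y (by linarith [hx.1]) hxy hy.2
  have hI2 : IntervalIntegrable (fun r => r ^ 2 * ρ r) volume r₀ 1 :=
    hρ.continuousOn_mul (by fun_prop)
  have hI3 : IntervalIntegrable (fun r => r * ρ r) volume r₀ 1 :=
    hρ.continuousOn_mul (by fun_prop)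
  have hsplit := intervalIntegral.integral_add_adjacent_intervals hI1 hI2
  have hA : 0 ≤ ∫ s in (0:ℝ)..r₀, s ^ 2 * ρ s :=
    intervalIntegral.integral_nonneg hr₀.le (fun s _ => mul_nonneg (sq_nonneg s) (hpos s))
  have hkey : ∫ s in r₀..1, ρ (10/11) * (s - 11/10 * s ^ 2)
      ≤ ∫ s in r₀..1, (s * ρ s - 11/10 * (s ^ 2 * ρ s)) := by
    apply intervalIntegral.integral_mono_on hle
    · exact Continuous.intervalIntegrable (by fun_prop) _ _
    · exact hI3.sub (hI2.const_mul _)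
    · intro s hs
      have hs0 : 0 < s := by linarith [hs.1]
      have : 0 ≤ s * ((ρ s - ρ (10/11)) * (1 - 11/10 * s)) := by
        apply mul_nonneg hs0.le
        rcases le_total s (10/11) with h | h
        · exact mul_nonneg (by linarith [hanti s (10/11) hs0 h (by norm_num)]) (by linarith)
        · exact mul_nonneg_of_nonpos_of_nonpos
            (by linarith [hanti (10/11) s (by norm_num) h hs.2]) (by linarith)
      nlinarith [this]
  rw [intervalIntegral.integral_sub hI3 (hI2.const_mul _), intervalIntegral.integral_const_mul,
    intervalIntegral.integral_const_mul,
    intervalIntegral.integral_sub (Continuous.intervalIntegrable (by fun_prop) _ _)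
      (Continuous.intervalIntegrable (by fun_prop) _ _), intervalIntegral.integral_const_mul,
    integral_id, integral_pow] at hkey
  norm_num at hkey
  have hc : 0 ≤ ρ (10/11) * ((1 - r₀ ^ 2) / 2 - 11/10 * ((1 - r₀ ^ 3) / 3)) := by
    apply mul_nonneg (hpos _)
    have : 0 < r₀ ^ 3 := by positivity
    nlinarith
  unfold U
  set A := ∫ s in (0:ℝ)..r₀, s ^ 2 * ρ s
  set B := ∫ s in r₀..1, s ^ 2 * ρ s
  set C := ∫ s in r₀..1, s * ρ s
  rw [← hsplit] at hmass
  have hdiv : 11/10 * A ≤ A / r₀ := by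
    rw [le_div_iff₀ hr₀]; nlinarith
  have hfin : 11/10 * (A + B) ≤ A / r₀ + C := by linarith
  have h4 := mul_le_mul_of_nonneg_left hfin (by positivity : 0 ≤ 4 * π)
  have e : -(4 * π / r₀) * A - 4 * π * C = -(4 * π * (A / r₀ + C)) := by ring
  rw [e]
  linarith
end
end

section
/- Let ρ ∈ D, let r₀ ∈ (0, 1/10] and r₁ ∈ (r₀, 1) with r₁³ ≥ 4/5, and assume 4π ∫₀^{r₀} s² ρ(s) ds < (11/10) r₀. Then 4π ∫_{r₀}^{r₁} s² ρ(s) ds ≥ 1/2. -/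
open MeasureTheory Real

noncomputable section

/-- If `ρ ∈ D`, `r₀ ∈ (0,1/10]`, `r₁ ∈ (r₀,1)` with `r₁³ ≥ 4/5`, and
`4π ∫₀^{r₀} s² ρ(s) ds < (11/10) r₀`, then `4π ∫_{r₀}^{r₁} s² ρ(s) ds ≥ 1/2`. -/
theorem stmt_6 (ρ : ℝ → ℝ) (hρ : memD ρ) (r₀ r₁ : ℝ) (hr₀ : 0 < r₀) (hr₀' : r₀ ≤ 1/10)
    (hr₁ : r₀ < r₁) (hr₁' : r₁ < 1) (hr₁'' : 4/5 ≤ r₁ ^ 3)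
    (h : 4 * π * (∫ s in (0:ℝ)..r₀, s ^ 2 * ρ s) < (11/10) * r₀) :
    1/2 ≤ 4 * π * ∫ s in r₀..r₁, s ^ 2 * ρ s := by
  obtain ⟨-, hnn, hmono, -, hmass⟩ := hρ
  have hπ : 0 < 4 * π := by positivity
  have hI : IntervalIntegrable (fun s => s ^ 2 * ρ s) volume 0 1 := by
    by_contra hc
    rw [intervalIntegral.integral_undef hc] at hmass
    simp at hmass
  have h1pos : 0 < r₁ := hr₀.trans hr₁
  have hA : IntervalIntegrable (fun s => s ^ 2 * ρ s) volume 0 r₀ :=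
    hI.mono_set (by
      rw [Set.uIcc_of_le hr₀.le, Set.uIcc_of_le zero_le_one]
      exact Set.Icc_subset_Icc le_rfl (by linarith))
  have hB : IntervalIntegrable (fun s => s ^ 2 * ρ s) volume r₀ r₁ :=
    hI.mono_set (by
      rw [Set.uIcc_of_le hr₁.le, Set.uIcc_of_le zero_le_one]
      exact Set.Icc_subset_Icc hr₀.le hr₁'.le)
  have hC : IntervalIntegrable (fun s => s ^ 2 * ρ s) volume r₁ 1 :=
    hI.mono_set (by
      rw [Set.uIcc_of_le hr₁'.le, Set.uIcc_of_le zero_le_one]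
      exact Set.Icc_subset_Icc h1pos.le le_rfl)
  have e1 := intervalIntegral.integral_add_adjacent_intervals hA hB
  have e2 := intervalIntegral.integral_add_adjacent_intervals (hA.trans hB) hC
  have hpoly : ∀ a b : ℝ, IntervalIntegrable (fun s : ℝ => s ^ 2 * ρ r₁) volume a b :=
    fun a b => (by fun_prop : Continuous (fun s : ℝ => s ^ 2 * ρ r₁)).intervalIntegrable a b
  have hval : ∀ a b : ℝ, ∫ s in a..b, s ^ 2 * ρ r₁ = (b ^ 3 - a ^ 3) / 3 * ρ r₁ := by
    intro a b
    rw [intervalIntegral.integral_mul_const, integral_pow]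
    norm_num
  have hM : (r₁ ^ 3 - r₀ ^ 3) / 3 * ρ r₁ ≤ ∫ s in r₀..r₁, s ^ 2 * ρ s := by
    rw [← hval]
    refine intervalIntegral.integral_mono_on hr₁.le (hpoly _ _) hB ?_
    intro x hx
    exact mul_le_mul_of_nonneg_left
      (hmono x r₁ (hr₀.trans_le hx.1) hx.2 hr₁'.le) (sq_nonneg x)
  have hT : (∫ s in r₁..1, s ^ 2 * ρ s) ≤ (1 ^ 3 - r₁ ^ 3) / 3 * ρ r₁ := by
    rw [← hval]
    refine intervalIntegral.integral_mono_on hr₁'.le hC (hpoly _ _) ?_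
    intro x hx
    exact mul_le_mul_of_nonneg_left (hmono r₁ x h1pos hx.1 hx.2) (sq_nonneg x)
  have hr3 : r₀ ^ 3 ≤ (1 / 10) ^ 3 := pow_le_pow_left₀ hr₀.le hr₀' 3
  have hc := hnn r₁
  have hTM : 3 * (∫ s in r₁..1, s ^ 2 * ρ s) ≤ ∫ s in r₀..r₁, s ^ 2 * ρ s := by
    have : 3 * ((1 ^ 3 - r₁ ^ 3) / 3 * ρ r₁) ≤ (r₁ ^ 3 - r₀ ^ 3) / 3 * ρ r₁ := by
      rw [← mul_assoc]
      exact mul_le_mul_of_nonneg_right (by linarith) hc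
    linarith
  rw [← e2, ← e1] at hmass
  have := mul_le_mul_of_nonneg_left hTM hπ.le
  linarith
end
end

section
/- Let ρ ∈ D, let r₀ ∈ (0, 1/10] and r₁ ∈ (r₀, 1) with r₁³ ≥ 4/5, set δ = min{1/10, (1/r₁ - 1)/2}, and assume 4π ∫₀^{r₀} s² ρ(s) ds < (11/10) r₀. Then 4π ∫_{r₀}^1 s ρ(s) ds ≥ (1 + δ) · 4π ∫_{r₀}^1 s² ρ(s) ds. -/
open MeasureTheory Real

noncomputable section

/-- If `ρ ∈ D`, `r₀ ∈ (0,1/10]`, `r₁ ∈ (r₀,1)` with `r₁³ ≥ 4/5`,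
`δ = min {1/10, (1/r₁-1)/2}`, and `4π ∫₀^{r₀} s² ρ(s) ds < (11/10) r₀`, then
`4π ∫_{r₀}^1 s ρ(s) ds ≥ (1+δ) 4π ∫_{r₀}^1 s² ρ(s) ds`. -/
theorem stmt_7 (ρ : ℝ → ℝ) (hρ : memD ρ) (r₀ r₁ : ℝ) (hr₀ : 0 < r₀) (hr₀' : r₀ ≤ 1/10)
    (hr₁ : r₀ < r₁) (hr₁' : r₁ < 1) (hr₁'' : 4/5 ≤ r₁ ^ 3)
    (δ : ℝ) (hδ : δ = min (1/10) ((1/r₁ - 1)/2))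
    (h : 4 * π * (∫ s in (0:ℝ)..r₀, s ^ 2 * ρ s) < (11/10) * r₀) :
    (1 + δ) * (4 * π * ∫ s in r₀..(1:ℝ), s ^ 2 * ρ s)
      ≤ 4 * π * ∫ s in r₀..(1:ℝ), s * ρ s := by
  obtain ⟨-, hnn, hmono, -, -⟩ := hρ
  have hr₁0 : 0 < r₁ := hr₀.trans hr₁
  have hδ1 : δ ≤ 1/10 := by rw [hδ]; exact min_le_left _ _
  have hδ0 : 0 ≤ δ := by
    rw [hδ]
    have : 1 ≤ 1 / r₁ := by rw [le_div_iff₀ hr₁0]; linarith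
    exact le_min (by norm_num) (by linarith)
  have h01 : r₀ ≤ 1 := by linarith
  have hint : IntervalIntegrable ρ volume r₀ 1 := by
    apply AntitoneOn.intervalIntegrable
    rw [Set.uIcc_of_le h01]
    intro a ha b hb hab
    exact hmono a b (lt_of_lt_of_le hr₀ ha.1) hab hb.2
  have h1 : IntervalIntegrable (fun s => s * ρ s) volume r₀ 1 :=
    hint.continuousOn_mul (by fun_prop)
  have h2 : IntervalIntegrable (fun s => s ^ 2 * ρ s) volume r₀ 1 :=
    hint.continuousOn_mul (by fun_prop)
  set c : ℝ := 1 / (1 + δ) with hc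
  have hd : 0 < 1 + δ := by linarith
  have hc0 : 0 < c := by positivity
  have hc1 : c ≤ 1 := by rw [hc, div_le_one hd]; linarith
  have hcd : c * (1 + δ) = 1 := by rw [hc]; field_simp
  have key : ∫ s in r₀..(1:ℝ), (s - (1 + δ) * s ^ 2) * ρ c
      ≤ ∫ s in r₀..(1:ℝ), (s * ρ s - (1 + δ) * (s ^ 2 * ρ s)) := by
    apply intervalIntegral.integral_mono_on h01
    · exact Continuous.intervalIntegrable (by fun_prop) _ _
    · exact h1.sub (h2.const_mul _)
    · intro s hs
      have hs0 : 0 < s := lt_of_lt_of_le hr₀ hs.1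
      have e : s * ρ s - (1 + δ) * (s ^ 2 * ρ s) - (s - (1 + δ) * s ^ 2) * ρ c
          = s * ((1 + δ) * ((c - s) * (ρ s - ρ c))) := by
        linear_combination (-(s * (ρ s - ρ c))) * hcd
      have : 0 ≤ (c - s) * (ρ s - ρ c) := by
        rcases le_total s c with hsc | hsc
        · exact mul_nonneg (by linarith) (by linarith [hmono s c hs0 hsc hc1])
        · exact mul_nonneg_of_nonpos_of_nonpos (by linarith)
            (by linarith [hmono c s hc0 hsc hs.2])
      have : 0 ≤ s * ((1 + δ) * ((c - s) * (ρ s - ρ c))) := by positivity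
      linarith
  rw [intervalIntegral.integral_sub h1 (h2.const_mul _),
    intervalIntegral.integral_const_mul, intervalIntegral.integral_mul_const,
    intervalIntegral.integral_sub (Continuous.intervalIntegrable (by fun_prop) _ _)
      (Continuous.intervalIntegrable (by fun_prop) _ _),
    intervalIntegral.integral_const_mul, integral_id, integral_pow] at key
  norm_num at key
  have hpos : 0 ≤ (1 - r₀ ^ 2) / 2 - (1 + δ) * ((1 - r₀ ^ 3) / 3) := by
    have a1 : r₀ ^ 2 ≤ 1/100 := by nlinarith
    have a2 : 0 < r₀ ^ 3 := by positivity
    nlinarith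
  have hp2 := mul_nonneg hpos (hnn c)
  have hfin : (1 + δ) * (∫ s in r₀..(1:ℝ), s ^ 2 * ρ s) ≤ ∫ s in r₀..(1:ℝ), s * ρ s := by
    linarith
  have hpi : 0 ≤ 4 * π := by positivity
  have := mul_le_mul_of_nonneg_left hfin hpi
  linarith
end
end

section
/- Let -1 < k < 3/2. Then for every ρ ∈ D, 4π ∫₀¹ r² max(-1 - U_ρ(r), 0)^{k+3/2} dr ≤ 4π ∫₀¹ s^{1/2 - k} ds = 4π/(3/2 - k) < ∞. -/
open MeasureTheory Real

noncomputable section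

lemma neg_U_le (ρ : ℝ → ℝ) (hρ : memD ρ) (r : ℝ) (hr : 0 < r) (hr1 : r ≤ 1) :
    -U ρ r ≤ 1 / r := by
  obtain ⟨_, hnn, _, _, hmass⟩ := hρ
  have hint : IntervalIntegrable (fun s : ℝ => s ^ 2 * ρ s) volume 0 1 := by
    by_contra h
    rw [intervalIntegral.integral_undef h] at hmass
    norm_num at hmass
  have h1 : IntervalIntegrable (fun s : ℝ => s ^ 2 * ρ s) volume 0 r :=
    hint.mono_set (by
      rw [Set.uIcc_of_le hr.le, Set.uIcc_of_le zero_le_one]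
      exact Set.Icc_subset_Icc le_rfl hr1)
  have h2 : IntervalIntegrable (fun s : ℝ => s ^ 2 * ρ s) volume r 1 :=
    hint.mono_set (by
      rw [Set.uIcc_of_le hr1, Set.uIcc_of_le zero_le_one]
      exact Set.Icc_subset_Icc hr.le le_rfl)
  have hadd := intervalIntegral.integral_add_adjacent_intervals h1 h2
  have hle : (∫ s in r..1, s * ρ s) ≤ ∫ s in r..1, (1 / r) * (s ^ 2 * ρ s) := by
    rw [intervalIntegral.integral_of_le hr1, intervalIntegral.integral_of_le hr1]
    apply integral_mono_of_nonneg
    · filter_upwards [ae_restrict_mem measurableSet_Ioc] with s hs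
      exact mul_nonneg (hr.trans hs.1).le (hnn s)
    · exact ((h2.const_mul (1 / r)).1)
    · filter_upwards [ae_restrict_mem measurableSet_Ioc] with s hs
      have hs0 : 0 < s := hr.trans hs.1
      have : s ≤ (1 / r) * s ^ 2 := by
        rw [one_div, inv_mul_eq_div, le_div_iff₀ hr]
        nlinarith [hs.1]
      calc s * ρ s ≤ ((1 / r) * s ^ 2) * ρ s := mul_le_mul_of_nonneg_right this (hnn s)
        _ = _ := by ring
  rw [intervalIntegral.integral_const_mul] at hle
  have hpi := Real.pi_pos
  have h3 := mul_le_mul_of_nonneg_left hle (by positivity : 0 ≤ 4 * π)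
  have h4 : 4 * π / r * (∫ s in (0:ℝ)..r, s ^ 2 * ρ s)
      + 4 * π * (1 / r * ∫ s in r..1, s ^ 2 * ρ s) = 1 / r := by
    calc _ = (4 * π * ((∫ s in (0:ℝ)..r, s ^ 2 * ρ s) + ∫ s in r..1, s ^ 2 * ρ s)) / r := by ring
      _ = 1 / r := by rw [hadd, hmass]
  unfold U
  linarith

/-- For `-1 < k < 3/2` and every `ρ ∈ D`:
`4π ∫₀¹ r² (-1 - U_ρ(r))₊^{k+3/2} dr ≤ 4π ∫₀¹ s^{1/2-k} ds = 4π/(3/2 - k)`. -/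
theorem stmt_10 (k : ℝ) (hk : -1 < k) (hk' : k < 3/2) (ρ : ℝ → ℝ) (hρ : memD ρ) :
    (4 * π * ∫ r in (0:ℝ)..1, r ^ 2 * (max (-1 - U ρ r) 0) ^ (k + 3/2)
        ≤ 4 * π * ∫ s in (0:ℝ)..1, s ^ (1/2 - k)) ∧
      4 * π * (∫ s in (0:ℝ)..1, s ^ (1/2 - k)) = 4 * π / (3/2 - k) := by
  have hpi := Real.pi_pos
  constructor
  · apply mul_le_mul_of_nonneg_left _ (by positivity)
    have hI : IntervalIntegrable (fun s : ℝ => s ^ (1/2 - k)) volume 0 1 :=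
      intervalIntegral.intervalIntegrable_rpow' (by linarith)
    rw [intervalIntegral.integral_of_le zero_le_one, intervalIntegral.integral_of_le zero_le_one]
    apply integral_mono_of_nonneg
    · filter_upwards with r
      simp only [Pi.zero_apply]
      positivity
    · exact hI.1
    · filter_upwards [ae_restrict_mem measurableSet_Ioc] with r hr
      have hr0 : 0 < r := hr.1
      have hU := neg_U_le ρ hρ r hr0 hr.2
      have hm : max (-1 - U ρ r) 0 ≤ r⁻¹ := by
        rw [← one_div]
        exact max_le (by linarith) (by positivity)
      have hp : (max (-1 - U ρ r) 0) ^ (k + 3/2) ≤ (r⁻¹) ^ (k + 3/2) :=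
        Real.rpow_le_rpow (le_max_right _ _) hm (by linarith)
      calc r ^ 2 * (max (-1 - U ρ r) 0) ^ (k + 3/2) ≤ r ^ 2 * (r⁻¹) ^ (k + 3/2) :=
            mul_le_mul_of_nonneg_left hp (by positivity)
        _ = r ^ (1/2 - k) := by
            rw [Real.inv_rpow hr0.le, ← Real.rpow_neg hr0.le, ← Real.rpow_two,
              ← Real.rpow_add hr0]
            congr 1
            ring
  · rw [integral_rpow (Or.inl (by linarith))]
    have h0 : (1/2 - k + 1 : ℝ) = 3/2 - k := by ring
    rw [h0, Real.one_rpow, Real.zero_rpow (by linarith)]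
    ring
end
end

section
/- Let -1 < k < 3/2 and c_k := 4π√2 ∫₀¹ η^k √(1-η) dη. Then there exist constants C₁, C₂ > 0 such that for every ρ ∈ D the amplitude A(ρ) := ( c_k · 4π ∫₀¹ r² max(-1 - U_ρ(r), 0)^{k+3/2} dr )^{-1} satisfies C₁ ≤ A(ρ) ≤ C₂. -/
open MeasureTheory Real

noncomputable section

/-- The constant `c_k = 4π√2 ∫₀¹ η^k √(1-η) dη`. -/
def ck (k : ℝ) : ℝ := 4 * π * Real.sqrt 2 * ∫ η in (0:ℝ)..1, η ^ k * Real.sqrt (1 - η)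

/-- The normalising amplitude `A(ρ) = (c_k · 4π ∫₀¹ r² (-1-U_ρ(r))₊^{k+3/2} dr)⁻¹`. -/
def Amp (k : ℝ) (ρ : ℝ → ℝ) : ℝ :=
  (ck k * (4 * π * ∫ r in (0:ℝ)..1, r ^ 2 * (max (-1 - U ρ r) 0) ^ (k + 3/2)))⁻¹

/-- The mass-preserving map `T(ρ)(r) = A(ρ) c_k (-1 - U_ρ(r))₊^{k+3/2}`. -/
def Tmap (k : ℝ) (ρ : ℝ → ℝ) (r : ℝ) : ℝ :=
  Amp k ρ * ck k * (max (-1 - U ρ r) 0) ^ (k + 3/2)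

open Set in
lemma ck_pos_aux (k : ℝ) (hk : -1 < k) : 0 < ck k := by
  unfold ck
  have : 0 < ∫ η in (0:ℝ)..1, η ^ k * Real.sqrt (1 - η) := by
    apply intervalIntegral.intervalIntegral_pos_of_pos_on
    · exact (intervalIntegral.intervalIntegrable_rpow' hk).mul_continuousOn (by fun_prop)
    · intro x hx
      have h1 := Real.rpow_pos_of_pos hx.1 k
      have h2 : 0 < Real.sqrt (1 - x) := Real.sqrt_pos.2 (by linarith [hx.2])
      positivity
    · norm_num
  positivity

lemma memD_int {ρ : ℝ → ℝ} (h : memD ρ) :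
    IntervalIntegrable (fun s => s ^ 2 * ρ s) volume 0 1 := by
  by_contra hc
  have := h.2.2.2.2
  rw [intervalIntegral.integral_undef hc] at this
  norm_num at this

lemma memD_int' {ρ : ℝ → ℝ} (h : memD ρ) {a b : ℝ} (ha : 0 ≤ a) (hab : a ≤ b) (hb : b ≤ 1) :
    IntervalIntegrable (fun s => s ^ 2 * ρ s) volume a b := by
  apply (memD_int h).mono_set
  rw [Set.uIcc_of_le hab, Set.uIcc_of_le zero_le_one]
  exact Set.Icc_subset_Icc ha hb

lemma memD_int1 {ρ : ℝ → ℝ} (h : memD ρ) {a b : ℝ} (ha : 0 < a) (hab : a ≤ b) (hb : b ≤ 1) :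
    IntervalIntegrable (fun s => s * ρ s) volume a b := by
  have h1 := (memD_int' h ha.le hab hb).continuousOn_mul (g := fun s => s⁻¹)
    (by
      rw [Set.uIcc_of_le hab]
      exact continuousOn_inv₀.mono (fun x hx => ne_of_gt (lt_of_lt_of_le ha hx.1)))
  refine h1.congr ?_
  intro x hx
  rw [Set.uIoc_of_le hab] at hx
  have : x ≠ 0 := ne_of_gt (ha.trans hx.1)
  simp only
  field_simp

lemma memD_upper {ρ : ℝ → ℝ} (h : memD ρ) {a b : ℝ} (ha : 0 < a) (hab : a ≤ b) (hb : b ≤ 1) :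
    a * (∫ s in a..b, s * ρ s) ≤ ∫ s in a..b, s ^ 2 * ρ s := by
  rw [← intervalIntegral.integral_const_mul]
  apply intervalIntegral.integral_mono_on hab ((memD_int1 h ha hab hb).const_mul a)
    (memD_int' h ha.le hab hb)
  intro x hx
  have := h.2.1 x
  have := hx.1
  have : 0 ≤ (x - a) * (x * ρ x) :=
    mul_nonneg (by linarith) (mul_nonneg (by linarith) (by linarith))
  nlinarith

lemma memD_lower {ρ : ℝ → ℝ} (h : memD ρ) {a b : ℝ} (ha : 0 < a) (hab : a ≤ b) (hb : b ≤ 1) :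
    (∫ s in a..b, s ^ 2 * ρ s) ≤ b * (∫ s in a..b, s * ρ s) := by
  rw [← intervalIntegral.integral_const_mul]
  apply intervalIntegral.integral_mono_on hab
    (memD_int' h ha.le hab hb) ((memD_int1 h ha hab hb).const_mul b)
  intro x hx
  have := h.2.1 x
  have := hx.1
  have := hx.2
  have : 0 ≤ (b - x) * (x * ρ x) :=
    mul_nonneg (by linarith) (mul_nonneg (by linarith) (by linarith))
  nlinarith

lemma memD_half {ρ : ℝ → ℝ} (h : memD ρ) :
    (∫ s in (0:ℝ)..1, s ^ 2 * ρ s) ≤ 8 * ∫ s in (0:ℝ)..(1/2), s ^ 2 * ρ s := by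
  have e : (∫ s in (0:ℝ)..1, s ^ 2 * ρ s)
      = 2 * ∫ t in (0:ℝ)..(1/2), (2 * t) ^ 2 * ρ (2 * t) := by
    rw [intervalIntegral.integral_comp_mul_left (fun s => s ^ 2 * ρ s) (two_ne_zero)]
    norm_num
    ring
  have i1 : IntervalIntegrable (fun t => (2 * t) ^ 2 * ρ (2 * t)) volume 0 (1/2) := by
    have := (memD_int h).comp_mul_left (c := 2)
    simpa using this
  have : (∫ t in (0:ℝ)..(1/2), (2 * t) ^ 2 * ρ (2 * t))
      ≤ ∫ t in (0:ℝ)..(1/2), 4 * (t ^ 2 * ρ t) := by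
    apply intervalIntegral.integral_mono_on_of_le_Ioo (by norm_num) i1
      ((memD_int' h le_rfl (by norm_num) (by norm_num)).const_mul 4)
    intro x hx
    have := h.2.2.1 x (2 * x) hx.1 (by linarith [hx.1]) (by linarith [hx.2])
    nlinarith [sq_nonneg x]
  rw [intervalIntegral.integral_const_mul] at this
  linarith

lemma negU_le {ρ : ℝ → ℝ} (h : memD ρ) {r : ℝ} (hr : 0 < r) (hr1 : r ≤ 1) :
    - U ρ r ≤ r⁻¹ := by
  have h1 := memD_upper h hr hr1 le_rfl
  have h2 := intervalIntegral.integral_add_adjacent_intervals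
    (memD_int' h le_rfl hr.le hr1) (memD_int' h hr.le hr1 le_rfl)
  have h3 := h.2.2.2.2
  rw [← h2] at h3
  unfold U
  have e : (-(-(4 * π / r) * (∫ s in (0:ℝ)..r, s ^ 2 * ρ s) - 4 * π * (∫ s in r..1, s * ρ s)))
    = (4 * π * ((∫ s in (0:ℝ)..r, s ^ 2 * ρ s) + r * (∫ s in r..1, s * ρ s))) * r⁻¹ := by
    field_simp
    ring
  rw [e]
  have hi : 0 < r⁻¹ := inv_pos.2 hr
  have : (4 * π * ((∫ s in (0:ℝ)..r, s ^ 2 * ρ s) + r * (∫ s in r..1, s * ρ s))) ≤ 1 := by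
    refine le_trans ?_ h3.le
    have := pi_pos
    gcongr
  nlinarith

lemma le_negU {ρ : ℝ → ℝ} (h : memD ρ) {r : ℝ} (hr : 0 < r) (hr1 : r ≤ 1/2) :
    1/8 ≤ -1 - U ρ r := by
  have hh := memD_half h
  have h1 := memD_lower h hr hr1 (by norm_num)
  have h1' := memD_lower h (a := 1/2) (b := 1) (by norm_num) (by norm_num) le_rfl
  have h2 := intervalIntegral.integral_add_adjacent_intervals
    (memD_int' h le_rfl hr.le (by linarith)) (memD_int' h hr.le hr1 (by norm_num))
  have h2' := intervalIntegral.integral_add_adjacent_intervals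
    (memD_int' h (b := 1/2) le_rfl (by norm_num) (by norm_num))
    (memD_int' h (a := 1/2) (by norm_num) (by norm_num) le_rfl)
  have h4 := intervalIntegral.integral_add_adjacent_intervals
    (memD_int1 h hr hr1 (by norm_num))
    (memD_int1 h (a := 1/2) (by norm_num) (by norm_num) le_rfl)
  have h3 := h.2.2.2.2
  have h0 : 0 ≤ ∫ s in (0:ℝ)..r, s ^ 2 * ρ s :=
    intervalIntegral.integral_nonneg hr.le (fun x _ => mul_nonneg (sq_nonneg x) (h.2.1 x))
  unfold U
  rw [← h4]
  have hi : 2 ≤ r⁻¹ := by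
    rw [le_inv_comm₀ (by norm_num) hr]; linarith
  have e : 2 * (∫ s in (0:ℝ)..r, s ^ 2 * ρ s) ≤ r⁻¹ * ∫ s in (0:ℝ)..r, s ^ 2 * ρ s := by gcongr
  rw [div_eq_mul_inv (4 * π) r]
  have key : 9/8 * (∫ s in (0:ℝ)..1, s ^ 2 * ρ s) ≤
      r⁻¹ * (∫ s in (0:ℝ)..r, s ^ 2 * ρ s)
        + ((∫ s in r..(1/2), s * ρ s) + ∫ s in (1/2)..1, s * ρ s) := by linarith
  have := mul_le_mul_of_nonneg_left key (by positivity : 0 ≤ 4 * π)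
  linarith

lemma U_meas {ρ : ℝ → ℝ} (h : memD ρ) :
    AEMeasurable (U ρ) (volume.restrict (Set.Ioc 0 1)) := by
  have m1 : AEMeasurable (fun r => ∫ s in (0:ℝ)..r, s ^ 2 * ρ s)
      (volume.restrict (Set.Ioc 0 1)) := by
    apply aemeasurable_restrict_of_monotoneOn measurableSet_Ioc
    intro a ha b hb hab
    have h2 := intervalIntegral.integral_add_adjacent_intervals
      (memD_int' h le_rfl ha.1.le ha.2) (memD_int' h ha.1.le hab hb.2)
    have h0 : 0 ≤ ∫ s in a..b, s ^ 2 * ρ s :=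
      intervalIntegral.integral_nonneg hab (fun x _ => mul_nonneg (sq_nonneg x) (h.2.1 x))
    simp only
    linarith
  have m2 : AEMeasurable (fun r => ∫ s in r..1, s * ρ s)
      (volume.restrict (Set.Ioc 0 1)) := by
    apply aemeasurable_restrict_of_antitoneOn measurableSet_Ioc
    intro a ha b hb hab
    have h2 := intervalIntegral.integral_add_adjacent_intervals
      (memD_int1 h ha.1 hab hb.2) (memD_int1 h hb.1 hb.2 le_rfl)
    have h0 : 0 ≤ ∫ s in a..b, s * ρ s :=
      intervalIntegral.integral_nonneg hab
        (fun x hx => mul_nonneg (ha.1.le.trans hx.1) (h.2.1 x))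
    simp only
    linarith
  unfold U
  have m3 : AEMeasurable (fun r : ℝ => -(4 * π / r)) (volume.restrict (Set.Ioc 0 1)) := by
    apply Measurable.aemeasurable
    fun_prop
  exact (m3.mul m1).sub (m2.const_mul _)

lemma integrand_le {ρ : ℝ → ℝ} (h : memD ρ) {p : ℝ} (hp : 0 < p) {r : ℝ} (hr : 0 < r)
    (hr1 : r ≤ 1) : r ^ 2 * (max (-1 - U ρ r) 0) ^ p ≤ r ^ (2 - p) := by
  have h1 := negU_le h hr hr1
  have hi : 0 < r⁻¹ := inv_pos.2 hr
  have : (max (-1 - U ρ r) 0) ^ p ≤ (r⁻¹) ^ p := by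
    apply Real.rpow_le_rpow (le_max_right _ _) (max_le (by linarith) hi.le) hp.le
  calc _ ≤ r ^ 2 * (r⁻¹) ^ p := by gcongr
    _ = _ := by
      rw [Real.rpow_sub hr, Real.inv_rpow hr.le, div_eq_mul_inv]
      norm_num

lemma integrand_int {ρ : ℝ → ℝ} (h : memD ρ) {p : ℝ} (hp : 0 < p) (hp3 : p < 3) :
    IntervalIntegrable (fun r => r ^ 2 * (max (-1 - U ρ r) 0) ^ p) volume 0 1 := by
  have i := intervalIntegral.intervalIntegrable_rpow' (a := 0) (b := 1)
    (show -1 < 2 - p by linarith)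
  rw [intervalIntegrable_iff_integrableOn_Ioc_of_le zero_le_one] at i ⊢
  refine Integrable.mono' i ?_ ?_
  · apply AEMeasurable.aestronglyMeasurable
    have := U_meas h
    fun_prop
  · filter_upwards [ae_restrict_mem measurableSet_Ioc] with r hr
    rw [Real.norm_of_nonneg
      (mul_nonneg (sq_nonneg r) (Real.rpow_nonneg (le_max_right _ _) _))]
    exact integrand_le h hp hr.1 hr.2

lemma int_upper {ρ : ℝ → ℝ} (h : memD ρ) {p : ℝ} (hp : 0 < p) (hp3 : p < 3) :
    (∫ r in (0:ℝ)..1, r ^ 2 * (max (-1 - U ρ r) 0) ^ p) ≤ 1 / (3 - p) := by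
  have e : (∫ r in (0:ℝ)..1, r ^ (2 - p)) = 1 / (3 - p) := by
    rw [integral_rpow (Or.inl (by linarith))]
    rw [Real.one_rpow, Real.zero_rpow (by linarith)]
    ring_nf
  rw [← e]
  apply intervalIntegral.integral_mono_on_of_le_Ioo zero_le_one (integrand_int h hp hp3)
    (intervalIntegral.intervalIntegrable_rpow' (by linarith))
  intro r hr
  exact integrand_le h hp hr.1 hr.2.le

lemma int_lower {ρ : ℝ → ℝ} (h : memD ρ) {p : ℝ} (hp : 0 < p) (hp3 : p < 3) :
    1 / 24 * (1 / 8 : ℝ) ^ p ≤ ∫ r in (0:ℝ)..1, r ^ 2 * (max (-1 - U ρ r) 0) ^ p := by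
  have i := integrand_int h hp hp3
  have i1 := i.mono_set (c := 0) (d := 1/2) (by
    rw [Set.uIcc_of_le (by norm_num), Set.uIcc_of_le zero_le_one]
    exact Set.Icc_subset_Icc le_rfl (by norm_num))
  have i2 := i.mono_set (c := 1/2) (d := 1) (by
    rw [Set.uIcc_of_le (by norm_num), Set.uIcc_of_le zero_le_one]
    exact Set.Icc_subset_Icc (by norm_num) le_rfl)
  rw [← intervalIntegral.integral_add_adjacent_intervals i1 i2]
  have h0 : 0 ≤ ∫ r in (1/2:ℝ)..1, r ^ 2 * (max (-1 - U ρ r) 0) ^ p :=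
    intervalIntegral.integral_nonneg (by norm_num) (fun r _ =>
      mul_nonneg (sq_nonneg r) (Real.rpow_nonneg (le_max_right _ _) _))
  have e : (∫ r in (0:ℝ)..(1/2), r ^ 2 * (1 / 8 : ℝ) ^ p) = 1 / 24 * (1 / 8 : ℝ) ^ p := by
    rw [intervalIntegral.integral_mul_const, integral_pow]
    norm_num
  have : (∫ r in (0:ℝ)..(1/2), r ^ 2 * (1 / 8 : ℝ) ^ p)
      ≤ ∫ r in (0:ℝ)..(1/2), r ^ 2 * (max (-1 - U ρ r) 0) ^ p := by
    apply intervalIntegral.integral_mono_on_of_le_Ioo (by norm_num) _ i1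
    · intro r hr
      have := le_negU h hr.1 hr.2.le
      have : (1 / 8 : ℝ) ^ p ≤ (max (-1 - U ρ r) 0) ^ p :=
        Real.rpow_le_rpow (by norm_num) (this.trans (le_max_left _ _)) hp.le
      gcongr
    · exact Continuous.intervalIntegrable (by fun_prop) _ _
  linarith

/-- For `-1 < k < 3/2` there are constants `C₁, C₂ > 0` with
`C₁ ≤ A(ρ) ≤ C₂` for every `ρ ∈ D`. -/
theorem stmt_11 (k : ℝ) (hk : -1 < k) (hk' : k < 3/2) :
    ∃ C₁ C₂ : ℝ, 0 < C₁ ∧ 0 < C₂ ∧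
      ∀ ρ : ℝ → ℝ, memD ρ → C₁ ≤ Amp k ρ ∧ Amp k ρ ≤ C₂ := by
  have hc := ck_pos_aux k hk
  have hp : 0 < k + 3/2 := by linarith
  have hp3 : k + 3/2 < 3 := by linarith
  have h3 : 0 < 3 - (k + 3/2) := by linarith
  have hl : (0:ℝ) < 1 / 24 * (1 / 8 : ℝ) ^ (k + 3/2) := by positivity
  refine ⟨(ck k * (4 * π * (1 / (3 - (k + 3/2)))))⁻¹,
    (ck k * (4 * π * (1 / 24 * (1 / 8 : ℝ) ^ (k + 3/2))))⁻¹, by positivity, by positivity, ?_⟩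
  intro ρ h
  have hu := int_upper h hp hp3
  have hlo := int_lower h hp hp3
  have hpos := hl.trans_le hlo
  unfold Amp
  constructor
  · apply inv_anti₀ (by positivity)
    gcongr
  · apply inv_anti₀ (by positivity)
    gcongr
end
end

section
/- Let -1 < k < 1/2 and let 3/2 < p < 3/(k + 3/2). Then there exists ρ* ∈ D such that T(ρ*) = ρ* as elements of L^p, i.e. ρ*(r) = A(ρ*) · c_k · max(-1 - U_{ρ*}(r), 0)^{k+3/2} for almost every r ∈ (0,1]. -/
open MeasureTheory Real

noncomputable section

/-- First radial moment. -/
def momOne (q : ℝ → ℝ) (r : ℝ) : ℝ := ∫ s in (0:ℝ)..r, s * q s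
/-- Second radial moment. -/
def momTwo (q : ℝ → ℝ) (r : ℝ) : ℝ := ∫ s in (0:ℝ)..r, s ^ 2 * q s
/-- The Volterra operator. -/
def volt (q : ℝ → ℝ) (r : ℝ) : ℝ := momOne q r - momTwo q r / r

/-- Admissible densities. -/
def adm (q : ℝ → ℝ) : Prop := Antitone q ∧ (∀ r, 0 ≤ q r) ∧ (∀ r, q r ≤ 1)

lemma adm_ii {q : ℝ → ℝ} (hq : adm q) {c : ℝ → ℝ} (hc : Continuous c) (a b : ℝ) :
    IntervalIntegrable (fun s => c s * q s) volume a b :=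
  (hq.1.intervalIntegrable).continuousOn_mul hc.continuousOn

lemma volt_eq {q : ℝ → ℝ} (hq : adm q) (r : ℝ) :
    volt q r = ∫ s in (0:ℝ)..r, (s - s ^ 2 / r) * q s := by
  unfold volt momOne momTwo
  rw [← intervalIntegral.integral_div, ← intervalIntegral.integral_sub
    (adm_ii hq (c := fun s => s) continuous_id 0 r) ((adm_ii hq (continuous_pow 2) 0 r).div_const r)]
  congr 1; ext s; ring

lemma ker_nonneg {s r : ℝ} (hr : 0 < r) (hs : 0 ≤ s) (hsr : s ≤ r) : 0 ≤ s - s ^ 2 / r := by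
  rw [sub_nonneg, div_le_iff₀ hr]; nlinarith

lemma momTwo_lower {q : ℝ → ℝ} (hq : adm q) {r : ℝ} (hr : 0 ≤ r) :
    q r * (r ^ 3 / 3) ≤ momTwo q r := by
  have : q r * (r ^ 3 / 3) = ∫ s in (0:ℝ)..r, s ^ 2 * q r := by
    rw [intervalIntegral.integral_mul_const, integral_pow]; norm_num; ring
  rw [this]
  apply intervalIntegral.integral_mono_on hr
  · exact (by fun_prop : Continuous fun s : ℝ => s ^ 2 * q r).intervalIntegrable _ _
  · exact adm_ii hq (continuous_pow 2) 0 r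
  · intro s hs
    exact mul_le_mul_of_nonneg_left (hq.1 hs.2) (sq_nonneg s)

lemma momTwo_mono {q : ℝ → ℝ} (hq : adm q) {r R : ℝ} (hR : r ≤ R) :
    momTwo q r ≤ momTwo q R := by
  unfold momTwo
  rw [← intervalIntegral.integral_add_adjacent_intervals
    (adm_ii hq (continuous_pow 2) 0 r) (adm_ii hq (continuous_pow 2) r R)]
  have : 0 ≤ ∫ s in r..R, s ^ 2 * q s :=
    intervalIntegral.integral_nonneg hR fun s _ => mul_nonneg (sq_nonneg s) (hq.2.1 s)
  linarith

lemma momTwo_nonneg {q : ℝ → ℝ} (hq : adm q) {r : ℝ} (hr : 0 ≤ r) : 0 ≤ momTwo q r :=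
  le_trans (mul_nonneg (hq.2.1 r) (by positivity)) (momTwo_lower hq hr)

lemma volt_step {q : ℝ → ℝ} (hq : adm q) {r R : ℝ} (hr : 0 < r) (hR : r ≤ R) :
    volt q r + momTwo q r * (1 / r - 1 / R) ≤ volt q R := by
  have hR0 : 0 < R := hr.trans_le hR
  have h1 : momOne q R = momOne q r + ∫ s in r..R, s * q s :=
    (intervalIntegral.integral_add_adjacent_intervals
      (adm_ii hq continuous_id 0 r) (adm_ii hq continuous_id r R)).symm
  have h2 : momTwo q R = momTwo q r + ∫ s in r..R, s ^ 2 * q s :=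
    (intervalIntegral.integral_add_adjacent_intervals
      (adm_ii hq (continuous_pow 2) 0 r) (adm_ii hq (continuous_pow 2) r R)).symm
  have h3 : 0 ≤ ∫ s in r..R, (s - s ^ 2 / R) * q s :=
    intervalIntegral.integral_nonneg hR fun s hs =>
      mul_nonneg (ker_nonneg hR0 (hr.le.trans hs.1) hs.2) (hq.2.1 s)
  have h4 : ∫ s in r..R, (s - s ^ 2 / R) * q s
      = (∫ s in r..R, s * q s) - (∫ s in r..R, s ^ 2 * q s) / R := by
    rw [← intervalIntegral.integral_div, ← intervalIntegral.integral_sub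
      (adm_ii hq (c := fun s => s) continuous_id r R) ((adm_ii hq (continuous_pow 2) r R).div_const R)]
    congr 1; ext s; ring
  unfold volt
  rw [h1, h2]
  rw [h4] at h3
  have : (momTwo q r + ∫ s in r..R, s ^ 2 * q s) / R
    = momTwo q r * (1 / R) + (∫ s in r..R, s ^ 2 * q s) / R := by ring
  rw [this]
  have : momTwo q r / r = momTwo q r * (1 / r) := by ring
  rw [this]
  linarith

lemma volt_mono {q : ℝ → ℝ} (hq : adm q) {r R : ℝ} (hr : 0 < r) (hR : r ≤ R) :
    volt q r ≤ volt q R := by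
  have := volt_step hq hr hR
  have h2 : 0 ≤ momTwo q r * (1 / r - 1 / R) :=
    mul_nonneg (momTwo_nonneg hq hr.le) (sub_nonneg.2 (one_div_le_one_div_of_le hr hR))
  linarith

lemma volt_le_volt {q q' : ℝ → ℝ} (hq : adm q) (hq' : adm q') {r : ℝ} (hr : 0 < r)
    (h : ∀ s, q s ≤ q' s) : volt q r ≤ volt q' r := by
  rw [volt_eq hq, volt_eq hq']
  apply intervalIntegral.integral_mono_on hr.le
  · exact adm_ii hq (by fun_prop) 0 r
  · exact adm_ii hq' (by fun_prop) 0 r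
  · intro s hs
    exact mul_le_mul_of_nonneg_left (h s) (ker_nonneg hr hs.1 hs.2)

lemma volt_nonneg {q : ℝ → ℝ} (hq : adm q) {r : ℝ} (hr : 0 < r) : 0 ≤ volt q r := by
  rw [volt_eq hq]
  exact intervalIntegral.integral_nonneg hr.le fun s hs =>
      mul_nonneg (ker_nonneg hr hs.1 hs.2) (hq.2.1 s)

lemma volt_one {q : ℝ → ℝ} (hq : adm q) : volt q 1 ≤ 1 / 2 := by
  rw [volt_eq hq]
  have : (1 / 2 : ℝ) = ∫ s in (0:ℝ)..1, s := by simp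
  rw [this]
  apply intervalIntegral.integral_mono_on zero_le_one
  · exact adm_ii hq (by fun_prop) 0 1
  · exact continuous_id.intervalIntegrable _ _
  · intro s hs
    have h1 := ker_nonneg zero_lt_one hs.1 hs.2
    have h2 := hq.2.1 s
    have h3 := hq.2.2 s
    nlinarith [sq_nonneg s]

lemma volt_cont {q : ℝ → ℝ} (hq : adm q) : ContinuousOn (volt q) (Set.Ioi 0) := by
  unfold volt
  have h1 : Continuous (momOne q) :=
    intervalIntegral.continuous_primitive (fun a b => adm_ii hq continuous_id a b) 0
  have h2 : Continuous (momTwo q) :=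
    intervalIntegral.continuous_primitive (fun a b => adm_ii hq (continuous_pow 2) a b) 0
  exact h1.continuousOn.sub (h2.continuousOn.div continuousOn_id fun x hx => (ne_of_gt hx))

lemma rpow_lip {n ε : ℝ} (hn : 0 < n) (hε : 0 < ε) :
    ∃ L : ℝ, 0 ≤ L ∧ ∀ a b : ℝ, ε ≤ a → a ≤ b → b ≤ 1 → b ^ n - a ^ n ≤ L * (b - a) := by
  refine ⟨n * max 1 (ε ^ (n - 1)), by positivity, fun a b ha hab hb => ?_⟩
  have := (convex_Icc ε 1).norm_image_sub_le_of_norm_hasDerivWithin_le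
    (f := fun x : ℝ => x ^ n) (f' := fun x => n * x ^ (n - 1)) (C := n * max 1 (ε ^ (n - 1)))
    (x := a) (y := b)
    (fun x hx => (Real.hasDerivAt_rpow_const (Or.inl (hε.trans_le hx.1).ne')).hasDerivWithinAt)
    ?_ ⟨ha, hab.trans hb⟩ ⟨ha.trans hab, hb⟩
  · rw [Real.norm_eq_abs, Real.norm_eq_abs, abs_of_nonneg (sub_nonneg.2 hab)] at this
    exact (le_abs_self _).trans this
  · intro x hx
    have hx0 := hε.trans_le hx.1
    rw [Real.norm_eq_abs, abs_of_nonneg (by positivity)]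
    apply mul_le_mul_of_nonneg_left _ hn.le
    rcases le_total 1 n with h | h
    · exact (Real.rpow_le_one hx0.le hx.2 (by linarith)).trans (le_max_left _ _)
    · exact (Real.rpow_le_rpow_of_nonpos hε hx.1 (by linarith)).trans (le_max_right _ _)

lemma gron {w : ℝ → ℝ} {C r : ℝ} (hC : 0 ≤ C) (hw1 : ∀ x, w x ≤ 1)
    (hwi : ∀ a b, IntervalIntegrable w volume a b)
    (h : ∀ x, 0 < x → x ≤ r → w x ≤ C * ∫ s in (0:ℝ)..x, w s) (hr : 0 < r) : w r ≤ 0 := by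
  have key : ∀ m : ℕ, ∀ x, 0 < x → x ≤ r → w x ≤ (C * x) ^ m / m.factorial := by
    intro m
    induction m with
    | zero => intro x _ _; simpa using hw1 x
    | succ m ih =>
      intro x hx hxr
      refine (h x hx hxr).trans ?_
      have h1 : ∫ s in (0:ℝ)..x, w s ≤ ∫ s in (0:ℝ)..x, (C ^ m / m.factorial) * s ^ m := by
        rw [intervalIntegral.integral_of_le hx.le, intervalIntegral.integral_of_le hx.le]
        apply setIntegral_mono_on (hwi 0 x).1 _ measurableSet_Ioc
        · intro s hs
          refine (ih s hs.1 (hs.2.trans hxr)).trans (le_of_eq ?_)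
          rw [mul_pow]; ring
        · exact ((by fun_prop : Continuous fun s : ℝ =>
            (C ^ m / m.factorial) * s ^ m).intervalIntegrable 0 x).1
      refine (mul_le_mul_of_nonneg_left h1 hC).trans (le_of_eq ?_)
      rw [intervalIntegral.integral_const_mul, integral_pow, Nat.factorial_succ]
      push_cast
      field_simp
      ring
  have := FloorSemiring.tendsto_pow_div_factorial_atTop (C * r)
  exact ge_of_tendsto' this fun m => key m r hr le_rfl

instance factZeroOne : Fact ((0:ℝ) ≤ 1) := ⟨zero_le_one⟩

/-- Lattice of monotone functions with values in the unit interval. -/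
abbrev MonUnit : Type := ℝ →o Set.Icc (0:ℝ) 1

/-- The density attached to `g`. -/
def qf (n : ℝ) (g : MonUnit) (s : ℝ) : ℝ := (1 - (g s : ℝ)) ^ n

lemma lat_nonneg (g : MonUnit) (s : ℝ) : 0 ≤ 1 - (g s : ℝ) := sub_nonneg.2 (g s).2.2

lemma qf_adm {n : ℝ} (hn : 0 < n) (g : MonUnit) : adm (qf n g) := by
  refine ⟨fun a b hab => ?_, fun r => Real.rpow_nonneg (lat_nonneg g r) n, fun r => ?_⟩
  · apply Real.rpow_le_rpow (lat_nonneg g b) _ hn.le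
    have : (g a : ℝ) ≤ g b := g.monotone hab
    linarith
  · apply Real.rpow_le_one (lat_nonneg g r) _ hn.le
    have := (g r).2.1
    linarith

lemma qf_anti {n : ℝ} (hn : 0 < n) {g h : MonUnit} (hgh : g ≤ h) (s : ℝ) : qf n h s ≤ qf n g s := by
  apply Real.rpow_le_rpow (lat_nonneg h s) _ hn.le
  have : (g s : ℝ) ≤ h s := hgh s
  linarith

/-- The clipped Volterra map on the lattice. -/
def sMap (n : ℝ) (hn : 0 < n) (g : MonUnit) : MonUnit where
  toFun r := if hr : 0 < r then
      ⟨min 1 (volt (qf n g) r), le_min zero_le_one (volt_nonneg (qf_adm hn g) hr), min_le_left _ _⟩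
    else ⟨0, le_rfl, zero_le_one⟩
  monotone' := by
    intro a b hab
    by_cases ha : 0 < a
    · have hb : 0 < b := ha.trans_le hab
      simp only [ha, hb, dite_true]
      exact min_le_min_left _ (volt_mono (qf_adm hn g) ha hab)
    · simp only [ha, dite_false]
      exact (bot_le : (⊥ : Set.Icc (0:ℝ) 1) ≤ _)

lemma sMap_pos (n : ℝ) (hn : 0 < n) (g : MonUnit) {r : ℝ} (hr : 0 < r) :
    ((sMap n hn g r : Set.Icc (0:ℝ) 1) : ℝ) = min 1 (volt (qf n g) r) := by
  change ((dite (0 < r) _ _ : Set.Icc (0:ℝ) 1) : ℝ) = _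
  rw [dif_pos hr]

lemma sMap_anti (n : ℝ) (hn : 0 < n) {g h : MonUnit} (hgh : g ≤ h) : sMap n hn h ≤ sMap n hn g := by
  intro r
  by_cases hr : 0 < r
  · apply Subtype.coe_le_coe.1
    rw [sMap_pos n hn g hr, sMap_pos n hn h hr]
    exact min_le_min_left _ (volt_le_volt (qf_adm hn h) (qf_adm hn g) hr (qf_anti hn hgh))
  · change (dite (0 < r) _ _ : Set.Icc (0:ℝ) 1) ≤ dite (0 < r) _ _
    rw [dif_neg hr, dif_neg hr]

/-- Least-fixed-point principle for monotone self-maps of a complete lattice. -/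
lemma lfp_exists {α : Type*} [CompleteLattice α] (f : α → α)
    (hf : ∀ a b : α, a ≤ b → f a ≤ f b) : ∃ g, f g = g ∧ ∀ x, f x = x → g ≤ x := by
  have h1 : f (sInf {a | f a ≤ a}) ≤ sInf {a | f a ≤ a} :=
    le_sInf fun a ha => (hf _ _ (sInf_le ha)).trans ha
  refine ⟨sInf {a | f a ≤ a}, le_antisymm h1 (sInf_le (hf _ _ h1)), fun x hx => sInf_le hx.le⟩

lemma exists_pair (n : ℝ) (hn : 0 < n) :
    ∃ g h : MonUnit, g ≤ h ∧ sMap n hn g = h ∧ sMap n hn h = g := by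
  obtain ⟨g, hfix, hmin⟩ := lfp_exists (α := MonUnit) (fun g => sMap n hn (sMap n hn g))
    (fun a b hab => sMap_anti n hn (sMap_anti n hn hab))
  refine ⟨g, sMap n hn g, hmin _ ?_, rfl, hfix⟩
  exact congrArg (sMap n hn) hfix

lemma pair_eq {n : ℝ} (hn : 0 < n) {g h : MonUnit} (hgh : g ≤ h) (h1 : sMap n hn g = h)
    (h2 : sMap n hn h = g) {r : ℝ} (hr : 0 < r) (hlt : (h r : ℝ) < 1) : (g r : ℝ) = h r := by
  obtain ⟨L, hL, hLip⟩ := rpow_lip (n := n) (ε := 1 - (h r : ℝ)) hn (by linarith)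
  have hle : ∀ x, (g x : ℝ) ≤ h x := fun x => hgh x
  have hmg : Monotone fun s => (g s : ℝ) := fun a b hab => g.monotone hab
  have hmh : Monotone fun s => (h s : ℝ) := fun a b hab => h.monotone hab
  have hwi : ∀ a b, IntervalIntegrable (fun s => (h s : ℝ) - g s) volume a b := fun a b =>
    (hmh.intervalIntegrable).sub hmg.intervalIntegrable
  have := gron (w := fun s => (h s : ℝ) - g s) (C := L * r) (r := r) (by positivity)
    (fun x => by have := (h x).2.2; have := (g x).2.1; linarith) hwi ?_ hr
  · have := hle r

    linarith
  · intro x hx hxr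
    have hhx : (h x : ℝ) ≤ h r := hmh hxr
    have hgx := hle x
    have e1 : (h x : ℝ) = volt (qf n g) x := by
      have := sMap_pos n hn g hx
      rw [h1] at this
      rcases min_choice 1 (volt (qf n g) x) with h' | h' <;> rw [h'] at this <;> linarith
    have e2 : (g x : ℝ) = volt (qf n h) x := by
      have := sMap_pos n hn h hx
      rw [h2] at this
      rcases min_choice 1 (volt (qf n h) x) with h' | h' <;> rw [h'] at this <;> linarith

    rw [e1, e2, volt_eq (qf_adm hn g), volt_eq (qf_adm hn h),
      ← intervalIntegral.integral_sub (adm_ii (qf_adm hn g) (by fun_prop) 0 x)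
        (adm_ii (qf_adm hn h) (by fun_prop) 0 x), ← intervalIntegral.integral_const_mul]
    apply intervalIntegral.integral_mono_on hx.le
    · exact (adm_ii (qf_adm hn g) (by fun_prop) 0 x).sub (adm_ii (qf_adm hn h) (by fun_prop) 0 x)
    · exact (hwi 0 x).const_mul _
    · intro s hs
      have k0 := ker_nonneg hx hs.1 hs.2
      have k1 : s - s ^ 2 / x ≤ r := by
        have : 0 ≤ s ^ 2 / x := by positivity
        linarith [hs.2]
      have k2 : qf n g s - qf n h s ≤ L * ((h s : ℝ) - g s) := by
        have hhs : (h s : ℝ) ≤ h r := hmh (hs.2.trans hxr)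
        have := hLip (1 - h s) (1 - g s) (by linarith) (by linarith [hle s])
          (by linarith [(g s).2.1])
        unfold qf
        refine this.trans (le_of_eq (by ring))
      have k3 : 0 ≤ qf n g s - qf n h s := sub_nonneg.2 (qf_anti hn hgh s)
      calc _ = (s - s ^ 2 / x) * (qf n g s - qf n h s) := by ring
        _ ≤ r * (L * ((h s : ℝ) - g s)) := mul_le_mul k1 k2 k3 hr.le
        _ = _ := by ring

/-- No global positive solution. -/
lemma no_global {n : ℝ} (hn : 0 < n) (hn2 : n < 2) {g : MonUnit} (hlt : ∀ r, (g r : ℝ) < 1)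
    (hg : ∀ r, 0 < r → (g r : ℝ) = volt (qf n g) r) : False := by
  set θ : ℝ → ℝ := fun r => 1 - (g r : ℝ) with hθ
  have hpos : ∀ r, 0 < θ r := fun r => sub_pos.2 (hlt r)
  have hq := qf_adm hn g
  have hqθ : ∀ r, qf n g r = θ r ^ n := fun r => rfl
  have A : ∀ r, 0 < r → momTwo (qf n g) r / (2 * r) ≤ θ r := by
    intro r hr
    have := volt_step hq hr (by linarith : r ≤ 2 * r)
    rw [← hg r hr, ← hg (2 * r) (by linarith)] at this
    have h2 := hlt (2 * r)
    have e : momTwo (qf n g) r * (1 / r - 1 / (2 * r)) = momTwo (qf n g) r / (2 * r) := by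
      field_simp; ring
    rw [e] at this
    simp only [hθ]; linarith
  have B : ∀ r, 0 < r → r ^ 2 / 6 ≤ θ r ^ (1 - n) := by
    intro r hr
    have h1 := A r hr
    have h2 := momTwo_lower hq hr.le
    rw [hqθ] at h2
    have h3 : θ r ^ n * (r ^ 2 / 6) ≤ θ r := by
      refine le_trans ?_ h1
      rw [le_div_iff₀ (by positivity)]
      refine le_trans (le_of_eq ?_) h2
      ring
    rw [Real.rpow_sub (hpos r), Real.rpow_one, le_div_iff₀ (Real.rpow_pos_of_pos (hpos r) n)]
    linarith
  have hθ1 : ∀ r, θ r ≤ 1 := fun r => by simp only [hθ]; linarith [(g r).2.1]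
  set c := momTwo (qf n g) 1 / 2 with hc
  have hcpos : 0 < c := by
    have h2 := momTwo_lower hq zero_le_one
    rw [hqθ] at h2
    have := Real.rpow_pos_of_pos (hpos 1) n
    rw [hc]; linarith
  rcases le_total n 1 with h | h
  · have h1 := B 3 (by norm_num)
    have h2 := Real.rpow_le_one (hpos 3).le (hθ1 3) (by linarith : 0 ≤ 1 - n)
    linarith
  · -- `c / r ≤ θ r ≤ 1`
    have key : ∀ r, 1 ≤ r → r * c ≤ 6 := by
      intro r hr
      have hr0 : 0 < r := by linarith
      have h1 : c / r ≤ θ r := by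
        refine le_trans ?_ (A r hr0)
        rw [hc, div_div]
        exact div_le_div_of_nonneg_right (momTwo_mono hq hr) (by positivity)
      have hcr : 0 < c / r := by positivity
      have h2 : θ r ^ (1 - n) ≤ (c / r) ^ (1 - n) :=
        Real.rpow_le_rpow_of_nonpos hcr h1 (by linarith)
      have h3 : (c / r) ^ (1 - n) ≤ (c / r) ^ (-1 : ℝ) :=
        Real.rpow_le_rpow_of_exponent_ge hcr (h1.trans (hθ1 r)) (by linarith)
      have h4 := (B r hr0).trans (h2.trans h3)
      rw [Real.rpow_neg_one, inv_div, le_div_iff₀ hcpos] at h4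
      have : r * (r * c) ≤ r * 6 := by nlinarith
      exact le_of_mul_le_mul_left this hr0
    have := key (max 1 (7 / c)) (le_max_left _ _)
    have h5 : 7 / c * c ≤ max 1 (7 / c) * c :=
      mul_le_mul_of_nonneg_right (le_max_right _ _) hcpos.le
    rw [div_mul_cancel₀ _ hcpos.ne'] at h5
    linarith

/-- The Lane–Emden profile with a finite zero. -/
lemma exists_profile {n : ℝ} (hn : 0 < n) (hn2 : n < 2) :
    ∃ (g : MonUnit) (R : ℝ), 0 < R ∧ volt (qf n g) R = 1 ∧ 0 < momTwo (qf n g) R ∧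
      ∀ r, 0 < r → r ≤ R → (g r : ℝ) = volt (qf n g) r := by
  obtain ⟨g, h, hgh, h1, h2⟩ := exists_pair n hn
  have hq := qf_adm hn g
  have hh : ∀ {r : ℝ}, 0 < r → (h r : ℝ) = min 1 (volt (qf n g) r) := by
    intro r hr; rw [← sMap_pos n hn g hr, h1]
  have hgg : ∀ {r : ℝ}, 0 < r → (g r : ℝ) = min 1 (volt (qf n h) r) := by
    intro r hr; rw [← sMap_pos n hn h hr, h2]
  have hcon : ∀ {r : ℝ}, 0 < r → volt (qf n g) r < 1 → (g r : ℝ) = volt (qf n g) r := by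
    intro r hr hlt
    have e : (h r : ℝ) = volt (qf n g) r := by rw [hh hr, min_eq_right hlt.le]
    rw [pair_eq hn hgh h1 h2 hr (by rw [e]; exact hlt), e]
  have hex : ∃ R, 1 ≤ R ∧ 1 ≤ volt (qf n g) R := by
    by_contra! hno
    have hall : ∀ r, 0 < r → volt (qf n g) r < 1 := fun r hr =>
      (volt_mono hq hr (le_max_left r 1)).trans_lt (hno _ (le_max_right r 1))
    refine no_global hn hn2 (g := g) (fun r => ?_) (fun r hr => hcon hr (hall r hr))
    have hm : (g r : ℝ) ≤ g (max r 1) := g.monotone (le_max_left r 1)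
    have hp : 0 < max r 1 := lt_max_of_lt_right one_pos
    rw [hcon hp (hall _ hp)] at hm
    exact hm.trans_lt (hall _ hp)
  obtain ⟨R1, hR1, hv⟩ := hex
  have hv1 := volt_one hq
  obtain ⟨R, hR, hRv⟩ := intermediate_value_Icc hR1
    ((volt_cont hq).mono fun x hx => lt_of_lt_of_le one_pos hx.1)
    (show (1:ℝ) ∈ Set.Icc _ _ from ⟨by linarith, hv⟩)
  have hR0 : 0 < R := lt_of_lt_of_le one_pos hR.1
  have hmpos : ∀ r, 0 < r → 0 < momTwo (qf n g) r := by
    intro r hr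
    have hm0 : 0 < min r 1 := lt_min hr one_pos
    have a1 := momTwo_mono hq (min_le_left r 1)
    have a2 := momTwo_lower hq hm0.le
    have a3 : qf n g 1 ≤ qf n g (min r 1) := hq.1 (min_le_right r 1)
    have a4 : 0 < qf n g 1 := by
      apply Real.rpow_pos_of_pos
      rw [hcon one_pos (by linarith)]
      linarith
    have : 0 < qf n g (min r 1) * (min r 1 ^ 3 / 3) := mul_pos (by linarith) (by positivity)
    linarith
  have hlt : ∀ r, 0 < r → r < R → volt (qf n g) r < 1 := by
    intro r hr hrR
    have := volt_step hq hr hrR.le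
    have h5 : 0 < momTwo (qf n g) r * (1 / r - 1 / R) :=
      mul_pos (hmpos r hr) (sub_pos.2 (one_div_lt_one_div_of_lt hr hrR))
    linarith
  refine ⟨g, R, hR0, hRv, hmpos R hR0, fun r hr hrR => ?_⟩
  rcases hrR.lt_or_eq with hrR | rfl
  · exact hcon hr (hlt r hr hrR)
  · apply le_antisymm
    · rw [hRv]; exact (g r).2.2
    · have hc : ContinuousAt (volt (qf n g)) r := (volt_cont hq).continuousAt (Ioi_mem_nhds hr)
      have ht : Filter.Tendsto (volt (qf n g)) (nhdsWithin r (Set.Iio r))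
        (nhds (volt (qf n g) r)) := hc.tendsto.mono_left nhdsWithin_le_nhds
      apply le_of_tendsto ht
      filter_upwards [Ioo_mem_nhdsLT hr] with x hx
      rw [← hcon hx.1 (hlt x hx.1 hx.2)]
      exact g.monotone hx.2.le

lemma ck_pos {k : ℝ} (hk : -1 < k) : 0 < ck k := by
  unfold ck
  apply mul_pos (by positivity)
  apply intervalIntegral.intervalIntegral_pos_of_pos_on _ _ zero_lt_one
  · exact (intervalIntegral.intervalIntegrable_rpow' hk).mul_continuousOn
      (by fun_prop : Continuous fun η : ℝ => Real.sqrt (1 - η)).continuousOn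
  · intro x hx
    exact mul_pos (Real.rpow_pos_of_pos hx.1 _) (Real.sqrt_pos.2 (by linarith [hx.2]))

lemma scale_two (q : ℝ → ℝ) {R : ℝ} (hR : 0 < R) (r : ℝ) :
    ∫ s in (0:ℝ)..r, s ^ 2 * q (R * s) = momTwo q (R * r) / R ^ 3 := by
  have := intervalIntegral.integral_comp_mul_left (a := 0) (b := r)
    (fun s => s ^ 2 * q s) hR.ne'
  have e : ∫ s in (0:ℝ)..r, s ^ 2 * q (R * s)
      = (∫ s in (0:ℝ)..r, (R * s) ^ 2 * q (R * s)) / R ^ 2 := by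
    rw [← intervalIntegral.integral_div]
    congr 1; ext s; field_simp
  rw [e, this, mul_zero, smul_eq_mul]
  unfold momTwo
  field_simp

lemma scale_one {q : ℝ → ℝ} (hq : adm q) {R : ℝ} (hR : 0 < R) (r : ℝ) :
    ∫ s in r..1, s * q (R * s) = (momOne q R - momOne q (R * r)) / R ^ 2 := by
  have := intervalIntegral.integral_comp_mul_left (a := r) (b := 1)
    (fun s => s * q s) hR.ne'
  have e : ∫ s in r..1, s * q (R * s)
      = (∫ s in r..1, (R * s) * q (R * s)) / R := by
    rw [← intervalIntegral.integral_div]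
    congr 1; ext s; field_simp
  have e2 : momOne q R - momOne q (R * r) = ∫ s in (R * r)..R, s * q s :=
    intervalIntegral.integral_interval_sub_left
      (adm_ii hq continuous_id 0 R) (adm_ii hq continuous_id 0 (R * r))
  rw [e, this, mul_one, smul_eq_mul, e2]
  field_simp

/-- For `-1 < k < 1/2` and `3/2 < p < 3/(k+3/2)`, the operator `T` has a fixed
point `ρ* ∈ D`: `ρ*(r) = A(ρ*) c_k (-1 - U_{ρ*}(r))₊^{k+3/2}` for a.e.
`r ∈ (0,1]`. -/
theorem stmt_17 (k : ℝ) (hk : -1 < k) (hk' : k < 1/2)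
    (p : ℝ) (hp : 3/2 < p) (hp' : p < 3 / (k + 3/2)) :
    ∃ ρ : ℝ → ℝ, memD ρ ∧
      ∀ᵐ r : ℝ, r ∈ Set.Ioc (0:ℝ) 1 →
        ρ r = Amp k ρ * ck k * (max (-1 - U ρ r) 0) ^ (k + 3/2) := by
  have hn : 0 < k + 3/2 := by linarith
  obtain ⟨g, R, hR, hv, hM, hg⟩ := exists_profile hn (by linarith : k + 3/2 < 2)
  set n := k + 3/2 with hndef
  have hq := qf_adm hn g
  set q := qf n g with hqdef
  have hck := ck_pos hk
  have hpi := Real.pi_pos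
  set M := momTwo q R with hMdef
  set β := R ^ 3 / (4 * π * M) with hβ
  have hβ0 : 0 < β := by positivity
  set ρ : ℝ → ℝ := fun r => if r ≤ 1 then β * q (R * r) else 0 with hρ
  have hρ1 : ∀ {r}, r ≤ 1 → ρ r = β * q (R * r) := fun {r} hr => if_pos hr
  have I2 : ∀ r, 0 < r → r ≤ 1 →
      ∫ s in (0:ℝ)..r, s ^ 2 * ρ s = β * (momTwo q (R * r) / R ^ 3) := by
    intro r hr hr1
    rw [← scale_two q hR, ← intervalIntegral.integral_const_mul]
    apply intervalIntegral.integral_congr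
    intro s hs
    rw [Set.uIcc_of_le hr.le] at hs
    simp only
    rw [hρ1 (hs.2.trans hr1)]; ring
  have I1 : ∀ r, 0 < r → r ≤ 1 →
      ∫ s in r..1, s * ρ s = β * ((momOne q R - momOne q (R * r)) / R ^ 2) := by
    intro r hr hr1
    rw [← scale_one hq hR, ← intervalIntegral.integral_const_mul]
    apply intervalIntegral.integral_congr
    intro s hs
    rw [Set.uIcc_of_le hr1] at hs
    simp only
    rw [hρ1 hs.2]; ring
  set α := 4 * π * β / R ^ 2 with hα
  have hα0 : 0 < α := by positivity
  have hU : ∀ r, 0 < r → r ≤ 1 → -1 - U ρ r = α * (1 - (g (R * r) : ℝ)) := by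
    intro r hr hr1
    have hRr : R * r ≤ R := by nlinarith
    rw [hg (R * r) (by positivity) hRr]
    unfold U
    rw [I2 r hr hr1, I1 r hr hr1]
    have hv' : momOne q R = 1 + M / R := by
      have : momOne q R - M / R = 1 := hv
      linarith
    rw [hv', hα, hβ]
    unfold volt
    field_simp
    ring
  have hmax : ∀ r, 0 < r → r ≤ 1 → (max (-1 - U ρ r) 0) ^ n = α ^ n * q (R * r) := by
    intro r hr hr1
    rw [hU r hr hr1, max_eq_left (mul_nonneg hα0.le (lat_nonneg g _)),
      Real.mul_rpow hα0.le (lat_nonneg g _)]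
    rfl
  have hIntA : ∫ r in (0:ℝ)..1, r ^ 2 * (max (-1 - U ρ r) 0) ^ n = α ^ n * (M / R ^ 3) := by
    have h := scale_two q hR 1
    rw [mul_one] at h
    rw [hMdef, ← h, ← intervalIntegral.integral_const_mul,
      intervalIntegral.integral_of_le zero_le_one, intervalIntegral.integral_of_le zero_le_one]
    apply setIntegral_congr_fun measurableSet_Ioc
    intro s hs
    simp only
    rw [hmax s hs.1 hs.2]; ring
  have hαn : 0 < α ^ n := Real.rpow_pos_of_pos hα0 n
  refine ⟨ρ, ⟨?_, ?_, ?_, ?_, ?_⟩, Filter.Eventually.of_forall fun r hr => ?_⟩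
  · have : Measurable fun r => β * q (R * r) :=
      (hq.1.measurable.comp (measurable_const_mul R)).const_mul β
    exact Measurable.ite measurableSet_Iic this measurable_const
  · intro r
    simp only [hρ]
    split_ifs
    · exact mul_nonneg hβ0.le (hq.2.1 _)
    · exact le_rfl
  · intro r s _ hrs hs
    rw [hρ1 hs, hρ1 (hrs.trans hs)]
    exact mul_le_mul_of_nonneg_left (hq.1 (mul_le_mul_of_nonneg_left hrs hR.le)) hβ0.le
  · intro r hr
    exact if_neg (not_le.2 hr)
  · rw [I2 1 one_pos le_rfl, mul_one, ← hMdef, hβ]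
    field_simp
  · rw [hρ1 hr.2, hmax r hr.1 hr.2]
    unfold Amp
    rw [← hndef, hIntA, hβ]
    field_simp
end
end

section
/- Let -1 < k < 1/2. Then there exist a constant κ > 0 and a function ρ* ∈ D such that, with U* = U_{ρ*} and f*(x,v) := κ · max(-1 - |v|²/2 - U*(|x|), 0)^k for x, v ∈ ℝ³, one has ρ*(|x|) = ∫_{ℝ³} f*(x,v) dv for almost every x with 0 < |x| ≤ 1, and f*(x,v) = 0 whenever |x| > 1. In other words, the Vlasov–Poisson system admits a spherically symmetric steady state with polytropic ansatz f = κ (E₀ - E)_+^k, cut-off energy E₀ = -1, total mass 1, and support in the unit ball. -/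
open MeasureTheory Real

noncomputable section

/-- `x ↦ x^k` cut off to `0` where the base is nonpositive
(so that for `k < 0` the integrand is interpreted as `0` there). -/
def cutPow (x k : ℝ) : ℝ := if 0 < x then x ^ k else 0

namespace LE

open Set Filter Topology

/-- clamped power -/
def g (n x : ℝ) : ℝ := (max 0 (min x 1)) ^ n

lemma g_cont {n : ℝ} (hn : 0 < n) : Continuous (g n) := by
  unfold g
  exact (by fun_prop : Continuous fun x : ℝ => max 0 (min x 1)).rpow_const
    (fun x => Or.inr hn.le)

lemma g_nonneg (n x : ℝ) : 0 ≤ g n x := rpow_nonneg (le_max_left _ _) _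

lemma g_le_one {n : ℝ} (hn : 0 < n) (x : ℝ) : g n x ≤ 1 :=
  rpow_le_one (le_max_left _ _) (max_le zero_le_one (min_le_right _ _)) hn.le

lemma g_mono {n : ℝ} (hn : 0 < n) : Monotone (g n) := fun _ _ h =>
  rpow_le_rpow (le_max_left _ _) (max_le_max le_rfl (min_le_min h le_rfl)) hn.le

lemma g_eq {n x : ℝ} (h0 : 0 ≤ x) (h1 : x ≤ 1) : g n x = x ^ n := by
  unfold g; rw [min_eq_left h1, max_eq_right h0]

def M (h : ℝ → ℝ) (r : ℝ) : ℝ := ∫ s in (0:ℝ)..r, s ^ 2 * h s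
def N (h : ℝ → ℝ) (r : ℝ) : ℝ := ∫ s in (0:ℝ)..r, s * h s
def H (h : ℝ → ℝ) (r : ℝ) : ℝ := N h r - M h r / r

lemma H_zero (h : ℝ → ℝ) : H h 0 = 0 := by simp [H, N]

lemma M_deriv {h : ℝ → ℝ} (hc : Continuous h) (r : ℝ) : HasDerivAt (M h) (r ^ 2 * h r) r := by
  have : Continuous fun s => s ^ 2 * h s := by fun_prop
  exact intervalIntegral.integral_hasDerivAt_right (this.intervalIntegrable _ _)
    (this.stronglyMeasurableAtFilter _ _) this.continuousAt

lemma N_deriv {h : ℝ → ℝ} (hc : Continuous h) (r : ℝ) : HasDerivAt (N h) (r * h r) r := by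
  have : Continuous fun s => s * h s := by fun_prop
  exact intervalIntegral.integral_hasDerivAt_right (this.intervalIntegrable _ _)
    (this.stronglyMeasurableAtFilter _ _) this.continuousAt

lemma H_deriv {h : ℝ → ℝ} (hc : Continuous h) {r : ℝ} (hr : 0 < r) :
    HasDerivAt (H h) (M h r / r ^ 2) r := by
  have := (N_deriv hc r).sub ((M_deriv hc r).div (hasDerivAt_id r) hr.ne')
  refine HasDerivAt.congr_deriv (f := H h) this ?_
  simp only [id]
  field_simp
  ring

lemma M_diff {h : ℝ → ℝ} (hc : Continuous h) (a b : ℝ) :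
    M h b - M h a = ∫ s in a..b, s ^ 2 * h s := by
  have : Continuous fun s => s ^ 2 * h s := by fun_prop
  unfold M
  rw [intervalIntegral.integral_interval_sub_left] <;> exact this.intervalIntegrable _ _

lemma M_mono {h : ℝ → ℝ} (hc : Continuous h) (h0 : ∀ x, 0 ≤ h x) : Monotone (M h) := by
  intro a b hab
  have := M_diff hc a b
  have h2 : 0 ≤ ∫ s in a..b, s ^ 2 * h s :=
    intervalIntegral.integral_nonneg hab (fun s _ => mul_nonneg (sq_nonneg _) (h0 _))
  linarith

lemma M_zero (h : ℝ → ℝ) : M h 0 = 0 := by simp [M]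

lemma M_le {h : ℝ → ℝ} (hc : Continuous h) (h1 : ∀ x, h x ≤ 1) {r : ℝ} (hr : 0 ≤ r) :
    M h r ≤ r ^ 3 / 3 := by
  have : M h r ≤ ∫ s in (0:ℝ)..r, s ^ 2 := by
    apply intervalIntegral.integral_mono_on hr
    · exact Continuous.intervalIntegrable (by fun_prop) _ _
    · exact Continuous.intervalIntegrable (by fun_prop) _ _
    · intro x _; nlinarith [h1 x, sq_nonneg x]
  rw [integral_pow] at this
  norm_num at this
  linarith

lemma H_cont {h : ℝ → ℝ} (hc : Continuous h) (h0 : ∀ x, 0 ≤ h x) (h1 : ∀ x, h x ≤ 1) :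
    ContinuousOn (H h) (Ici 0) := by
  intro r hr
  rcases eq_or_lt_of_le (show (0:ℝ) ≤ r from hr) with rfl | hr
  · have e : ∀ r ∈ Ici (0:ℝ), ‖M h r / r‖ ≤ r ^ 2 := by
      intro r hr
      have hr : 0 ≤ r := hr
      have hm : 0 ≤ M h r := by rw [← M_zero h]; exact M_mono hc h0 hr
      rw [norm_of_nonneg (by positivity)]
      rcases eq_or_lt_of_le hr with rfl | hr
      · simp
      · rw [div_le_iff₀ hr]
        nlinarith [M_le hc h1 hr.le, pow_pos hr 3]
    have t : Tendsto (fun r => M h r / r) (𝓝[Ici 0] 0) (𝓝 0) := by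
      refine squeeze_zero_norm' (eventually_nhdsWithin_of_forall e) ?_
      have : Tendsto (fun r : ℝ => r ^ 2) (𝓝 0) (𝓝 (0 ^ 2)) := (continuous_pow 2).tendsto 0
      simpa using this.mono_left nhdsWithin_le_nhds
    have t2 : Tendsto (N h) (𝓝[Ici 0] 0) (𝓝 (N h 0)) :=
      (N_deriv hc 0).continuousAt.tendsto.mono_left nhdsWithin_le_nhds
    have := t2.sub t
    show Tendsto (fun r => N h r - M h r / r) _ (𝓝 (H h 0))
    simpa [H] using this
  · exact (H_deriv hc hr).continuousAt.continuousWithinAt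

lemma H_mono {h : ℝ → ℝ} (hc : Continuous h) (h0 : ∀ x, 0 ≤ h x) (h1 : ∀ x, h x ≤ 1) :
    MonotoneOn (H h) (Ici 0) := by
  apply monotoneOn_of_deriv_nonneg (convex_Ici 0) (H_cont hc h0 h1)
  · intro x hx
    rw [interior_Ici] at hx
    exact (H_deriv hc hx).differentiableAt.differentiableWithinAt
  · intro x hx
    rw [interior_Ici] at hx
    rw [(H_deriv hc hx).deriv]
    have hm : 0 ≤ M h x := by rw [← M_zero h]; exact M_mono hc h0 (le_of_lt hx)
    positivity

lemma H_lip {h : ℝ → ℝ} (hc : Continuous h) (h0 : ∀ x, 0 ≤ h x) (h1 : ∀ x, h x ≤ 1)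
    {R a b : ℝ} (ha : 0 ≤ a) (hab : a ≤ b) (hb : b ≤ R) :
    H h b - H h a ≤ R / 3 * (b - a) := by
  apply (convex_Icc 0 R).image_sub_le_mul_sub_of_deriv_le
    ((H_cont hc h0 h1).mono Icc_subset_Ici_self) ?_ ?_ a ⟨ha, hab.trans hb⟩ b ⟨ha.trans hab, hb⟩ hab
  · intro x hx
    rw [interior_Icc] at hx
    exact (H_deriv hc hx.1).differentiableAt.differentiableWithinAt
  · intro x hx
    rw [interior_Icc] at hx
    rw [(H_deriv hc hx.1).deriv, div_le_iff₀ (pow_pos hx.1 2)]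
    nlinarith [M_le hc h1 hx.1.le, mul_le_mul_of_nonneg_right hx.2.le (sq_nonneg x)]

lemma H_congr {h h' : ℝ → ℝ} {r : ℝ} (hr : 0 ≤ r) (e : ∀ s, 0 ≤ s → s ≤ r → h s = h' s) :
    H h r = H h' r := by
  unfold H N M
  congr 1
  · apply intervalIntegral.integral_congr
    intro s hs
    rw [uIcc_of_le hr] at hs
    simp only [e s hs.1 hs.2]
  · congr 1
    apply intervalIntegral.integral_congr
    intro s hs
    rw [uIcc_of_le hr] at hs
    simp only [e s hs.1 hs.2]

/-- Tonelli approximations -/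
lemma tonelli {n : ℝ} (hn : 0 < n) {ε : ℝ} (hε : 0 < ε) (j : ℕ) :
    ∃ y : ℝ → ℝ, Continuous y ∧
      ∀ r, r ≤ j * ε → y r = 1 - H (fun s => g n (y s)) (max 0 (r - ε)) := by
  induction j with
  | zero =>
    refine ⟨fun _ => 1, continuous_const, fun r hr => ?_⟩
    rw [max_eq_left (by simp at hr; linarith), H_zero, sub_zero]
  | succ j ih =>
    obtain ⟨y, hy, e⟩ := ih
    have hc : Continuous fun s => g n (y s) := (g_cont hn).comp hy
    refine ⟨fun r => 1 - H (fun s => g n (y s)) (max 0 (r - ε)), ?_, fun r hr => ?_⟩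
    · refine continuous_const.sub ?_
      exact (H_cont hc (fun _ => g_nonneg _ _) (fun _ => g_le_one hn _)).comp_continuous
        (by fun_prop) (fun r => mem_Ici.2 (le_max_left _ _))
    · show 1 - _ = 1 - _
      congr 1
      apply H_congr (le_max_left _ _)
      intro s hs hs'
      congr 1
      apply e
      push_cast at hr
      rcases le_max_iff.1 hs' with h | h
      · have : 0 ≤ (j:ℝ) * ε := by positivity
        linarith
      · linarith

lemma exists_sol {n : ℝ} (hn : 0 < n) {R : ℝ} (hR : 0 < R) :
    ∃ y : ℝ → ℝ, Continuous y ∧ ∀ r ∈ Icc 0 R, y r = 1 - H (fun s => g n (y s)) r := by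
  have key : ∀ i : ℕ, ∃ y : ℝ → ℝ, Continuous y ∧
      ∀ r, r ≤ R → y r = 1 - H (fun s => g n (y s)) (max 0 (r - 1 / ((i:ℝ) + 1))) := by
    intro i
    obtain ⟨j, hj⟩ := exists_nat_ge (R / (1 / ((i:ℝ) + 1)))
    obtain ⟨y, hy, e⟩ := tonelli hn (ε := 1 / ((i:ℝ) + 1)) (by positivity) j
    refine ⟨y, hy, fun r hr => e r (hr.trans ?_)⟩
    rwa [div_le_iff₀ (by positivity)] at hj
  choose y hy e using key
  have hc : ∀ i, Continuous fun s => g n (y i s) := fun i => (g_cont hn).comp (hy i)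
  have h0 : ∀ i s, 0 ≤ g n (y i s) := fun i s => g_nonneg _ _
  have h1 : ∀ i s, g n (y i s) ≤ 1 := fun i s => g_le_one hn _
  -- two-sided Lipschitz estimate for H
  have lipH : ∀ i, ∀ a ∈ Icc 0 R, ∀ b ∈ Icc 0 R,
      |H (fun s => g n (y i s)) a - H (fun s => g n (y i s)) b| ≤ R / 3 * |a - b| := by
    intro i a ha b hb
    rcases le_total a b with hab | hab
    · have k1 := H_lip (hc i) (h0 i) (h1 i) ha.1 hab hb.2
      have k2 := H_mono (hc i) (h0 i) (h1 i) ha.1 hb.1 hab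
      rw [abs_sub_comm a, abs_sub_comm (H _ a), abs_of_nonneg (by linarith),
        abs_of_nonneg (by linarith)]
      exact k1
    · have k1 := H_lip (hc i) (h0 i) (h1 i) hb.1 hab ha.2
      have k2 := H_mono (hc i) (h0 i) (h1 i) hb.1 ha.1 hab
      rw [abs_of_nonneg (by linarith), abs_of_nonneg (by linarith)]
      exact k1
  have pm : ∀ i : ℕ, ∀ r ∈ Icc 0 R, max 0 (r - 1 / ((i:ℝ) + 1)) ∈ Icc 0 R := by
    intro i r hr
    have : (0:ℝ) < 1 / ((i:ℝ) + 1) := by positivity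
    exact ⟨le_max_left _ _, max_le hR.le (by linarith [hr.2])⟩
  have lipy : ∀ i, ∀ a ∈ Icc 0 R, ∀ b ∈ Icc 0 R, |y i a - y i b| ≤ R / 3 * |a - b| := by
    intro i a ha b hb
    rw [e i a ha.2, e i b hb.2]
    have := lipH i _ (pm i a ha) _ (pm i b hb)
    have k : |max 0 (a - 1 / ((i:ℝ) + 1)) - max 0 (b - 1 / ((i:ℝ) + 1))| ≤ |a - b| := by
      have := abs_max_sub_max_le_abs (a - 1 / ((i:ℝ) + 1)) (b - 1 / ((i:ℝ) + 1)) 0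
      rw [max_comm 0, max_comm 0]
      refine this.trans (le_of_eq ?_)
      congr 1; ring
    rw [sub_sub_sub_cancel_left, abs_sub_comm]
    exact this.trans (mul_le_mul_of_nonneg_left k (by positivity))
  have bdy : ∀ i, ∀ a ∈ Icc 0 R, |y i a| ≤ 1 + R / 3 * R := by
    intro i a ha
    rw [e i a ha.2]
    have h0R : (0:ℝ) ∈ Icc 0 R := ⟨le_rfl, hR.le⟩
    have k := lipH i _ (pm i a ha) 0 h0R
    rw [H_zero, sub_zero, sub_zero, abs_of_nonneg (pm i a ha).1] at k
    have := mul_le_mul_of_nonneg_left (pm i a ha).2 (by positivity : 0 ≤ R / 3)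
    refine (abs_sub _ _).trans ?_
    rw [abs_one]; linarith
  let F : ℕ → BoundedContinuousFunction (Icc (0:ℝ) R) ℝ := fun i =>
    BoundedContinuousFunction.mkOfCompact ⟨fun x => y i x, (hy i).comp continuous_subtype_val⟩
  have cpt : IsCompact (closure (range F)) := by
    apply BoundedContinuousFunction.arzela_ascoli (Icc (-(1 + R / 3 * R)) (1 + R / 3 * R))
      isCompact_Icc
    · rintro f x ⟨i, rfl⟩
      exact abs_le.1 (bdy i x x.2)
    · apply LipschitzWith.uniformEquicontinuous _ (Real.toNNReal (R / 3)) _ |>.equicontinuous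
      rintro ⟨f, i, rfl⟩
      apply LipschitzWith.of_dist_le_mul
      intro a b
      rw [Real.coe_toNNReal _ (by positivity)]
      exact lipy i a a.2 b b.2
  obtain ⟨z, -, φ, hφ, hz⟩ := cpt.tendsto_subseq (x := F) (fun i => subset_closure ⟨i, rfl⟩)
  refine ⟨IccExtend hR.le z, z.continuous.Icc_extend', ?_⟩
  have conv : ∀ r ∈ Icc 0 R, Tendsto (fun i => y (φ i) r) atTop (𝓝 (IccExtend hR.le z r)) := by
    intro r hr
    rw [IccExtend_of_mem _ _ hr]
    exact (BoundedContinuousFunction.tendsto_iff_tendstoUniformly.1 hz).tendsto_at ⟨r, hr⟩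
  generalize hw : IccExtend hR.le z = w at conv
  intro r hr
  have hsub : ∀ s ∈ uIoc 0 r, s ∈ Icc 0 R := by
    intro s hs
    rw [uIoc_of_le hr.1] at hs
    exact ⟨hs.1.le, hs.2.trans hr.2⟩
  have cN : Tendsto (fun i => N (fun s => g n (y (φ i) s)) r) atTop (𝓝 (N (fun s => g n (w s)) r)) := by
    apply intervalIntegral.tendsto_integral_filter_of_dominated_convergence (fun s => |s|)
    · exact .of_forall fun i => (continuous_id.mul (hc (φ i))).aestronglyMeasurable
    · refine .of_forall fun i => .of_forall fun s _ => ?_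
      rw [norm_mul, norm_of_nonneg (h0 _ _)]
      exact mul_le_of_le_one_right (norm_nonneg _) (h1 _ _)
    · exact continuous_abs.intervalIntegrable _ _
    · refine .of_forall fun s hs => ?_
      exact (((g_cont hn).tendsto _).comp (conv s (hsub s hs))).const_mul _
  have cM : Tendsto (fun i => M (fun s => g n (y (φ i) s)) r) atTop (𝓝 (M (fun s => g n (w s)) r)) := by
    apply intervalIntegral.tendsto_integral_filter_of_dominated_convergence (fun s => |s ^ 2|)
    · exact .of_forall fun i => ((continuous_pow 2).mul (hc (φ i))).aestronglyMeasurable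
    · refine .of_forall fun i => .of_forall fun s _ => ?_
      rw [norm_mul, norm_of_nonneg (h0 _ _)]
      exact mul_le_of_le_one_right (norm_nonneg _) (h1 _ _)
    · exact (continuous_pow 2).abs.intervalIntegrable _ _
    · refine .of_forall fun s hs => ?_
      exact (((g_cont hn).tendsto _).comp (conv s (hsub s hs))).const_mul _
  have cH : Tendsto (fun i => 1 - H (fun s => g n (y (φ i) s)) r) atTop
      (𝓝 (1 - H (fun s => g n (w s)) r)) := (cN.sub (cM.div_const r)).const_sub 1
  have cd : Tendsto (fun i => y (φ i) r - (1 - H (fun s => g n (y (φ i) s)) r)) atTop (𝓝 0) := by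
    have t0 : Tendsto (fun i => R / 3 * (1 / ((φ i : ℝ) + 1))) atTop (𝓝 0) := by
      have := (tendsto_one_div_add_atTop_nhds_zero_nat (𝕜 := ℝ)).comp hφ.tendsto_atTop
      simpa using this.const_mul (R / 3)
    refine squeeze_zero_norm (fun i => ?_) t0
    rw [e (φ i) r hr.2, sub_sub_sub_cancel_left, norm_eq_abs]
    refine (lipH (φ i) r hr _ (pm _ r hr)).trans
      (mul_le_mul_of_nonneg_left ?_ (by positivity))
    have : (0:ℝ) < 1 / ((φ i:ℝ) + 1) := by positivity
    rw [abs_le]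
    constructor
    · rcases max_cases 0 (r - 1 / ((φ i:ℝ) + 1)) with h | h <;> linarith [hr.1]
    · linarith [le_max_right 0 (r - 1 / ((φ i:ℝ) + 1))]
  have := cd.add cH
  simp only [sub_add_cancel, zero_add] at this
  exact tendsto_nhds_unique (conv r hr) this

end LE

namespace LE

open Set Filter Topology

lemma hits {n : ℝ} (hn : 0 < n) (hn2 : n ≤ 2) :
    ∃ R : ℝ, 0 < R ∧ ∀ y : ℝ → ℝ, Continuous y →
      (∀ r ∈ Icc 0 R, y r = 1 - H (fun s => g n (y s)) r) → ∃ r ∈ Icc 0 R, y r ≤ 0 := by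
  obtain ⟨c, hcdef⟩ : ∃ c : ℝ, c = (1 / 18) ^ 2 := ⟨_, rfl⟩
  have hc0 : 0 < c := by rw [hcdef]; positivity
  set S : ℝ := exp (1 / c) with hS
  have hS1 : 1 ≤ S := one_le_exp (by positivity)
  refine ⟨2 * S, by positivity, fun y hy e => ?_⟩
  by_contra! hpos
  have hc : Continuous fun s => g n (y s) := (g_cont hn).comp hy
  have h0 : ∀ s, 0 ≤ g n (y s) := fun s => g_nonneg _ _
  have h1 : ∀ s, g n (y s) ≤ 1 := fun s => g_le_one hn _
  have glow : ∀ t x : ℝ, 0 < t → t ≤ 1 → t ≤ x → t ^ 2 ≤ g n x := by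
    intro t x ht0 ht1 htx
    calc t ^ 2 = t ^ (2:ℝ) := by norm_cast
      _ ≤ t ^ n := rpow_le_rpow_of_exponent_ge ht0 ht1 hn2
      _ = g n t := (g_eq ht0.le ht1).symm
      _ ≤ g n x := g_mono hn htx
  set h : ℝ → ℝ := fun s => g n (y s) with hh
  have hM1 : 1 / 9 ≤ M h 1 := by
    have : ∫ s in (0:ℝ)..1, s ^ 2 * (2 / 3) ^ 2 ≤ M h 1 := by
      apply intervalIntegral.integral_mono_on zero_le_one
      · exact Continuous.intervalIntegrable (by fun_prop) _ _
      · exact Continuous.intervalIntegrable (by fun_prop) _ _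
      · intro s hs
        refine mul_le_mul_of_nonneg_left ?_ (sq_nonneg _)
        apply glow _ _ (by norm_num) (by norm_num)
        rw [e s ⟨hs.1, by linarith [hs.2]⟩]
        have := H_lip hc h0 h1 le_rfl hs.1 hs.2
        rw [H_zero] at this
        linarith [hs.2]
    rw [intervalIntegral.integral_mul_const, integral_pow] at this
    norm_num at this
    linarith
  have hMr : ∀ r, 1 ≤ r → 1 / 9 ≤ M h r := fun r hr => hM1.trans (M_mono hc h0 hr)
  -- lower bound on y
  have ylow : ∀ r, 1 ≤ r → r ≤ S → 1 / 18 / r ≤ y r := by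
    intro r hr hrS
    have mono : MonotoneOn (fun r => H h r + 1 / 9 * r⁻¹) (Ici 1) := by
      have hd : ∀ x : ℝ, 0 < x → HasDerivAt (fun r => H h r + 1 / 9 * r⁻¹)
          (M h x / x ^ 2 + 1 / 9 * (-(x ^ 2)⁻¹)) x := fun x hx =>
        (H_deriv hc hx).add ((hasDerivAt_inv hx.ne').const_mul _)
      have gt : ∀ x ∈ Ici (1:ℝ), (0:ℝ) < x := fun x hx => lt_of_lt_of_le one_pos hx
      apply monotoneOn_of_deriv_nonneg (convex_Ici 1)
      · exact fun x hx => (hd x (gt x hx)).continuousAt.continuousWithinAt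
      · exact fun x hx =>
          (hd x (gt x (interior_subset hx))).differentiableAt.differentiableWithinAt
      · intro x hx
        have hx := interior_subset hx
        rw [(hd x (gt x hx)).deriv]
        have := mul_le_mul_of_nonneg_right (hMr x hx) (by positivity : 0 ≤ (x ^ 2)⁻¹)
        rw [div_eq_mul_inv]; linarith
    have k := mono (mem_Ici.2 hr) (mem_Ici.2 (by linarith : 1 ≤ 2 * S)) (by linarith)
    simp only at k
    have k2 := e r ⟨by linarith, by linarith⟩
    have k3 := e (2 * S) ⟨by linarith, le_rfl⟩
    have k4 := hpos (2 * S) ⟨by linarith, le_rfl⟩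
    have k5 : (2 * S)⁻¹ ≤ (2 * r)⁻¹ := by gcongr
    rw [mul_inv] at k5
    rw [mul_inv 2 r] at k5
    rw [mul_inv] at k
    rw [div_eq_mul_inv]
    linarith
  have hMlow : ∀ r, 1 ≤ r → r ≤ S → c * r ≤ M h r := by
    intro r hr hrS
    have : ∫ s in (1:ℝ)..r, c ≤ ∫ s in (1:ℝ)..r, s ^ 2 * h s := by
      apply intervalIntegral.integral_mono_on hr
      · exact Continuous.intervalIntegrable (by fun_prop) _ _
      · exact Continuous.intervalIntegrable (by fun_prop) _ _
      · intro s hs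
        have hs0 : 0 < s := by linarith [hs.1]
        have k := glow (1 / 18 / s) (y s) (by positivity)
          (by rw [div_le_one hs0]; linarith [hs.1]) (ylow s hs.1 (hs.2.trans hrS))
        calc c = s ^ 2 * (1 / 18 / s) ^ 2 := by rw [hcdef]; field_simp
          _ ≤ _ := mul_le_mul_of_nonneg_left k (sq_nonneg _)
    rw [← M_diff hc, intervalIntegral.integral_const, smul_eq_mul] at this
    have : c ≤ 1 / 9 := by rw [hcdef]; norm_num
    linarith
  have mono : MonotoneOn (fun r => H h r - c * log r) (Icc 1 S) := by
    have hd : ∀ x : ℝ, 0 < x → HasDerivAt (fun r => H h r - c * log r)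
        (M h x / x ^ 2 - c * x⁻¹) x := fun x hx =>
      (H_deriv hc hx).sub ((hasDerivAt_log hx.ne').const_mul _)
    have gt : ∀ x ∈ Icc (1:ℝ) S, (0:ℝ) < x := fun x hx => lt_of_lt_of_le one_pos hx.1
    apply monotoneOn_of_deriv_nonneg (convex_Icc 1 S)
    · exact fun x hx => (hd x (gt x hx)).continuousAt.continuousWithinAt
    · exact fun x hx =>
        (hd x (gt x (interior_subset hx))).differentiableAt.differentiableWithinAt
    · intro x hx
      have hx := interior_subset hx
      have hx0 := gt x hx
      rw [(hd x hx0).deriv]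
      have := mul_le_mul_of_nonneg_right (hMlow x hx.1 hx.2) (by positivity : 0 ≤ (x ^ 2)⁻¹)
      have e : c * x * (x ^ 2)⁻¹ = c * x⁻¹ := by field_simp
      rw [div_eq_mul_inv]; linarith
  have k := mono ⟨le_rfl, hS1⟩ ⟨hS1, le_rfl⟩ hS1
  simp only [log_one, mul_zero, sub_zero] at k
  rw [hS, log_exp, ← hS, mul_one_div_cancel hc0.ne'] at k
  have k1 : 0 ≤ H h 1 := by
    rw [← H_zero h]; exact H_mono hc h0 h1 (mem_Ici.2 le_rfl) (mem_Ici.2 zero_le_one) zero_le_one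
  have k2 := e S ⟨by linarith, by linarith⟩
  have k3 := hpos S ⟨by linarith, by linarith⟩
  linarith

/-- Lane and Emden solution up to its first zero. -/
lemma lane_emden {n : ℝ} (hn : 0 < n) (hn2 : n ≤ 2) :
    ∃ (R : ℝ) (y : ℝ → ℝ), 0 < R ∧ Continuous y ∧
      (∀ r ∈ Icc 0 R, y r = 1 - H (fun s => g n (y s)) r) ∧ y R = 0 ∧
      ∀ r ∈ Ico 0 R, 0 < y r := by
  obtain ⟨R₀, hR₀, hit⟩ := hits hn hn2
  obtain ⟨y, hy, e⟩ := exists_sol hn hR₀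
  have y0 : y 0 = 1 := by rw [e 0 ⟨le_rfl, hR₀.le⟩, H_zero, sub_zero]
  obtain ⟨r₁, hr₁, hz⟩ := hit y hy e
  obtain ⟨r₂, hr₂, hz₂⟩ : ∃ r ∈ Icc 0 r₁, y r = 0 :=
    intermediate_value_Icc' hr₁.1 hy.continuousOn ⟨hz, by rw [y0]; exact zero_le_one⟩
  have hcpt : IsCompact (Icc 0 r₁ ∩ y ⁻¹' {0}) :=
    isCompact_Icc.inter_right (isClosed_singleton.preimage hy)
  obtain ⟨R, hR, hleast⟩ := hcpt.exists_isLeast ⟨r₂, hr₂, hz₂⟩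
  have yR : y R = 0 := hR.2
  refine ⟨R, y, ?_, hy, fun r hr => e r ⟨hr.1, hr.2.trans (hR.1.2.trans hr₁.2)⟩, hR.2, ?_⟩
  · rcases eq_or_lt_of_le hR.1.1 with h | h
    · rw [← h, y0] at yR; norm_num at yR
    · exact h
  · intro r hr
    by_contra! hneg
    obtain ⟨r₃, hr₃, hz₃⟩ : ∃ s ∈ Icc 0 r, y s = 0 :=
      intermediate_value_Icc' hr.1 hy.continuousOn ⟨hneg, by rw [y0]; exact zero_le_one⟩
    have := hleast ⟨⟨hr₃.1, hr₃.2.trans (hr.2.le.trans hR.1.2)⟩, hz₃⟩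
    linarith [hr₃.2, hr.2]

end LE

namespace LE

open Set Filter Topology

abbrev E3 := EuclideanSpace ℝ (Fin 3)

def cint (k : ℝ) : ℝ := ∫ v : E3, cutPow (1 - ‖v‖ ^ 2 / 2) k

lemma cint_pos {k : ℝ} (hk : -1 < k) : 0 < cint k := by
  have h2 : (0:ℝ) < √2 := by positivity
  have sq2 : √2 ^ 2 = 2 := Real.sq_sqrt (by norm_num)
  have hpos : ∀ y ∈ Ioo 0 √2, 0 < 1 - y ^ 2 / 2 := by
    intro y hy
    have : y ^ 2 < √2 ^ 2 := pow_lt_pow_left₀ hy.2 hy.1.le (by norm_num)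
    linarith
  have hintg : IntegrableOn (fun y : ℝ => y * (1 - y ^ 2 / 2) ^ k) (Ioc 0 √2) := by
    apply intervalIntegral.integrableOn_deriv_of_nonneg
      (g := fun y => -((1 - y ^ 2 / 2) ^ (k + 1) / (k + 1)))
    · apply ContinuousOn.neg
      apply ContinuousOn.div_const
      apply ContinuousOn.rpow_const (by fun_prop)
      intro x _; right; linarith
    · intro y hy
      have hp := hpos y hy
      have d : HasDerivAt (fun y : ℝ => 1 - y ^ 2 / 2) (-y) y := by
        have := ((hasDerivAt_pow 2 y).div_const 2).const_sub 1
        refine this.congr_deriv ?_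
        norm_num
      have := ((d.rpow_const (p := k + 1) (Or.inl hp.ne')).div_const (k + 1)).fun_neg
      refine this.congr_deriv ?_
      have : k + 1 ≠ 0 := by linarith
      rw [add_sub_cancel_right]
      field_simp
    · intro y hy
      exact mul_nonneg hy.1.le (rpow_nonneg (hpos y hy).le _)
  have hintg2 : IntegrableOn (fun y : ℝ => y ^ 2 * (1 - y ^ 2 / 2) ^ k) (Ioo 0 √2) := by
    have : IntegrableOn (fun y : ℝ => √2 * (y * (1 - y ^ 2 / 2) ^ k)) (Ioo 0 √2) :=
      (hintg.mono_set Ioo_subset_Ioc_self).const_mul _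
    refine this.mono' ?_ ?_
    · apply ContinuousOn.aestronglyMeasurable _ measurableSet_Ioo
      apply ContinuousOn.mul (by fun_prop)
      apply ContinuousOn.rpow_const (by fun_prop)
      intro y hy; left; exact (hpos y hy).ne'
    · refine (ae_restrict_iff' measurableSet_Ioo).2 (.of_forall fun y hy => ?_)
      have hp := rpow_nonneg (hpos y hy).le k
      rw [norm_of_nonneg (by positivity)]
      have := mul_le_mul_of_nonneg_right hy.2.le (mul_nonneg hy.1.le hp)
      linarith [mul_assoc y y ((1 - y ^ 2 / 2) ^ k), congrArg (· * (1 - y ^ 2 / 2) ^ k) (sq y)]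
  have e : ∫ y in Ioi (0:ℝ), y ^ 2 * cutPow (1 - y ^ 2 / 2) k
      = ∫ y in Ioo 0 √2, y ^ 2 * (1 - y ^ 2 / 2) ^ k := by
    have e1 : ∫ y in Ioo 0 √2, y ^ 2 * (1 - y ^ 2 / 2) ^ k
        = ∫ y in Ioo 0 √2, y ^ 2 * cutPow (1 - y ^ 2 / 2) k := by
      apply setIntegral_congr_fun measurableSet_Ioo
      intro y hy
      simp only [cutPow, if_pos (hpos y hy)]
    rw [e1]
    apply setIntegral_eq_of_subset_of_forall_sdiff_eq_zero measurableSet_Ioi Ioo_subset_Ioi_self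
    intro y hy
    have hy0 : 0 < y := hy.1
    have : √2 ≤ y := by
      by_contra! hlt
      exact hy.2 ⟨hy0, hlt⟩
    have : √2 ^ 2 ≤ y ^ 2 := by gcongr
    rw [cutPow, if_neg (by linarith), mul_zero]
  have hI : 0 < ∫ y in Ioo 0 √2, y ^ 2 * (1 - y ^ 2 / 2) ^ k := by
    rw [setIntegral_pos_iff_support_of_nonneg_ae _ hintg2]
    · have : Ioo 0 √2 ⊆ (Function.support fun y : ℝ => y ^ 2 * (1 - y ^ 2 / 2) ^ k) ∩ Ioo 0 √2 := by
        intro y hy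
        refine ⟨?_, hy⟩
        have := rpow_pos_of_pos (hpos y hy) k
        have := hy.1
        rw [Function.mem_support]
        positivity
      refine lt_of_lt_of_le ?_ (measure_mono this)
      simp [h2]
    · refine (ae_restrict_iff' measurableSet_Ioo).2 (.of_forall fun y hy => ?_)
      exact mul_nonneg (sq_nonneg _) (rpow_nonneg (hpos y hy).le k)
  unfold cint
  rw [integral_fun_norm_addHaar volume (fun y => cutPow (1 - y ^ 2 / 2) k)]
  simp only [finrank_euclideanSpace, Fintype.card_fin, smul_eq_mul, nsmul_eq_mul]
  norm_num only
  rw [e]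
  have hb : 0 < volume.real (Metric.ball (0:E3) 1) :=
    ENNReal.toReal_pos (Metric.measure_ball_pos _ _ one_pos).ne' measure_ball_lt_top.ne
  positivity

lemma int_scale (k : ℝ) {a : ℝ} (ha : 0 < a) :
    ∫ v : E3, cutPow (a - ‖v‖ ^ 2 / 2) k = a ^ (k + 3 / 2) * cint k := by
  have hs : 0 < √a := by positivity
  have sq : √a ^ 2 = a := Real.sq_sqrt ha.le
  have e : ∀ v : E3, cutPow (a - ‖v‖ ^ 2 / 2) k
      = a ^ k * cutPow (1 - ‖(√a)⁻¹ • v‖ ^ 2 / 2) k := by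
    intro v
    have e1 : a - ‖v‖ ^ 2 / 2 = a * (1 - ‖(√a)⁻¹ • v‖ ^ 2 / 2) := by
      rw [norm_smul, norm_inv, norm_of_nonneg hs.le, mul_pow, inv_pow, sq]
      field_simp
    rw [e1]
    unfold cutPow
    by_cases hp : 0 < 1 - ‖(√a)⁻¹ • v‖ ^ 2 / 2
    · rw [if_pos hp, if_pos (by positivity), mul_rpow ha.le hp.le]
    · rw [if_neg hp, if_neg, mul_zero]
      rw [mul_pos_iff_of_pos_left ha]; exact hp
  simp_rw [e]
  rw [integral_const_mul,
    Measure.integral_comp_inv_smul volume (fun w : E3 => cutPow (1 - ‖w‖ ^ 2 / 2) k) (√a)]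
  rw [finrank_euclideanSpace, Fintype.card_fin, smul_eq_mul, abs_of_pos (by positivity),
    ← mul_assoc, rpow_add ha]
  congr 2
  rw [sqrt_eq_rpow, ← rpow_natCast, ← rpow_mul ha.le]
  norm_num

lemma int_zero (k : ℝ) {a : ℝ} (ha : a ≤ 0) :
    ∫ v : E3, cutPow (a - ‖v‖ ^ 2 / 2) k = 0 := by
  rw [← integral_zero E3 ℝ]
  congr 1
  ext v
  rw [cutPow, if_neg]
  nlinarith [sq_nonneg ‖v‖]

end LE

/-- For `-1 < k < 1/2` the Vlasov--Poisson system has a spherically symmetric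
steady state with polytropic ansatz `f = κ (E₀ - E)₊^k`, cut-off energy
`E₀ = -1`, total mass `1` and support in the unit ball: there are `κ > 0` and
`ρ* ∈ D` such that, with `f*(x,v) = κ (-1 - |v|²/2 - U_{ρ*}(|x|))₊^k`, one has
`ρ*(|x|) = ∫_{ℝ³} f*(x,v) dv` for a.e. `x` with `0 < |x| ≤ 1`, and
`f*(x,v) = 0` whenever `|x| > 1`. -/
theorem stmt_18 (k : ℝ) (hk : -1 < k) (hk' : k < 1/2) :
    ∃ κ : ℝ, 0 < κ ∧ ∃ ρ : ℝ → ℝ, memD ρ ∧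
      (∀ᵐ x : EuclideanSpace ℝ (Fin 3), 0 < ‖x‖ → ‖x‖ ≤ 1 →
        ρ ‖x‖ = ∫ v : EuclideanSpace ℝ (Fin 3),
          κ * cutPow (-1 - ‖v‖ ^ 2 / 2 - U ρ ‖x‖) k) ∧
      (∀ x v : EuclideanSpace ℝ (Fin 3), 1 < ‖x‖ →
        κ * cutPow (-1 - ‖v‖ ^ 2 / 2 - U ρ ‖x‖) k = 0) := by
  obtain ⟨n, hn⟩ : ∃ n : ℝ, n = k + 3 / 2 := ⟨_, rfl⟩
  have hn0 : 0 < n := by linarith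
  have hn2 : n ≤ 2 := by linarith
  obtain ⟨R, y, hR, hy, e, yR, ypos⟩ := LE.lane_emden hn0 hn2
  obtain ⟨h, hh⟩ : ∃ h : ℝ → ℝ, h = fun s => LE.g n (y s) := ⟨_, rfl⟩
  rw [← hh] at e
  have hc : Continuous h := by rw [hh]; exact (LE.g_cont hn0).comp hy
  have h0 : ∀ s, 0 ≤ h s := fun s => by rw [hh]; exact LE.g_nonneg _ _
  have h1 : ∀ s, h s ≤ 1 := fun s => by rw [hh]; exact LE.g_le_one hn0 _
  have ynn : ∀ r, 0 ≤ r → r ≤ R → 0 ≤ y r := by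
    intro r hr hrR
    rcases eq_or_lt_of_le hrR with rfl | hlt
    · exact yR.ge
    · exact (ypos r ⟨hr, hlt⟩).le
  have Hnn : ∀ r, 0 ≤ r → 0 ≤ LE.H h r := by
    intro r hr
    rw [← LE.H_zero h]
    exact LE.H_mono hc h0 h1 (Set.mem_Ici.2 le_rfl) (Set.mem_Ici.2 hr) hr
  have yle : ∀ r, 0 ≤ r → r ≤ R → y r ≤ 1 := by
    intro r hr hrR
    rw [e r ⟨hr, hrR⟩]; linarith [Hnn r hr]
  have hpow : ∀ r, 0 ≤ r → r ≤ R → h r = y r ^ n := by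
    intro r hr hrR
    rw [hh]; exact LE.g_eq (ynn r hr hrR) (yle r hr hrR)
  have hanti : ∀ r s, 0 ≤ r → r ≤ s → s ≤ R → h s ≤ h r := by
    intro r s hr hrs hsR
    rw [hh]
    apply LE.g_mono hn0
    rw [e r ⟨hr, hrs.trans hsR⟩, e s ⟨hr.trans hrs, hsR⟩]
    linarith [LE.H_mono hc h0 h1 (Set.mem_Ici.2 hr) (Set.mem_Ici.2 (hr.trans hrs)) hrs]
  have HR : LE.H h R = 1 := by have := e R ⟨hR.le, le_rfl⟩; linarith
  have hM : 0 < LE.M h R := by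
    apply intervalIntegral.intervalIntegral_pos_of_pos_on
      (Continuous.intervalIntegrable (by fun_prop) _ _) _ hR
    intro s hs
    have : 0 < h s := by
      rw [hpow s hs.1.le hs.2.le]; exact rpow_pos_of_pos (ypos s ⟨hs.1.le, hs.2⟩) _
    have := hs.1
    positivity
  obtain ⟨B, hB⟩ : ∃ B : ℝ, B = R ^ 3 / (4 * π * LE.M h R) := ⟨_, rfl⟩
  have hπ := pi_pos
  have hB0 : 0 < B := by rw [hB]; positivity
  have hBM : 4 * π * B = R ^ 3 / LE.M h R := by rw [hB]; field_simp
  obtain ⟨A, hA⟩ : ∃ A : ℝ, A = R / LE.M h R := ⟨_, rfl⟩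
  have hA0 : 0 < A := by rw [hA]; positivity
  have hcp := LE.cint_pos hk
  obtain ⟨ρ, hρ⟩ : ∃ ρ : ℝ → ℝ, ρ = fun r => if r ≤ 1 then B * h (R * r) else 0 := ⟨_, rfl⟩
  have ρle : ∀ r, r ≤ 1 → ρ r = B * h (R * r) := fun r hr => by rw [hρ]; exact if_pos hr
  have ρgt : ∀ r, 1 < r → ρ r = 0 := fun r hr => by rw [hρ]; exact if_neg (not_le.2 hr)
  -- integrals
  have I2 : ∀ r, 0 ≤ r → r ≤ 1 → ∫ s in (0:ℝ)..r, s ^ 2 * ρ s = B / R ^ 3 * LE.M h (R * r) := by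
    intro r hr hr1
    have e1 : ∫ s in (0:ℝ)..r, s ^ 2 * ρ s
        = ∫ s in (0:ℝ)..r, (B / R ^ 2) * (fun t => t ^ 2 * h t) (R * s) := by
      apply intervalIntegral.integral_congr
      intro s hs
      rw [Set.uIcc_of_le hr] at hs
      simp only [ρle s (hs.2.trans hr1)]
      field_simp
    rw [e1, intervalIntegral.integral_const_mul, intervalIntegral.integral_comp_mul_left (fun t => t ^ 2 * h t) hR.ne',
      mul_zero, smul_eq_mul]
    unfold LE.M
    field_simp
  have I1 : ∀ r, 0 ≤ r → r ≤ 1 →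
      ∫ s in r..1, s * ρ s = B / R ^ 2 * (LE.N h R - LE.N h (R * r)) := by
    intro r hr hr1
    have e1 : ∫ s in r..1, s * ρ s
        = ∫ s in r..1, (B / R) * (fun t => t * h t) (R * s) := by
      apply intervalIntegral.integral_congr
      intro s hs
      rw [Set.uIcc_of_le hr1] at hs
      simp only [ρle s hs.2]
      field_simp
    have hcc : Continuous fun t => t * h t := by fun_prop
    rw [e1, intervalIntegral.integral_const_mul, intervalIntegral.integral_comp_mul_left (fun t => t * h t) hR.ne',
      mul_one, smul_eq_mul]
    unfold LE.N
    rw [intervalIntegral.integral_interval_sub_left (hcc.intervalIntegrable _ _)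
      (hcc.intervalIntegrable _ _)]
    field_simp
  have mass : 4 * π * (∫ r in (0:ℝ)..1, r ^ 2 * ρ r) = 1 := by
    rw [I2 1 zero_le_one le_rfl, mul_one, hB]
    field_simp
  have pot : ∀ r, 0 < r → r ≤ 1 → -1 - U ρ r = A * y (R * r) := by
    intro r hr hr1
    have hRr : R * r ≤ R := by nlinarith
    have ey := e (R * r) ⟨by positivity, hRr⟩
    rw [← HR] at ey
    unfold U
    rw [I2 r hr.le hr1, I1 r hr.le hr1, ey, hA, hB]
    unfold LE.H
    field_simp
    ring
  have potgt : ∀ r, 1 < r → U ρ r = -(1 / r) := by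
    intro r hr
    have z1 : ∫ s in r..1, s * ρ s = 0 := by
      rw [intervalIntegral.integral_symm, intervalIntegral.integral_of_le hr.le,
        setIntegral_eq_zero_of_forall_eq_zero, neg_zero]
      intro s hs; rw [ρgt s hs.1, mul_zero]
    have z2 : ∫ s in (0:ℝ)..r, s ^ 2 * ρ s = ∫ s in (0:ℝ)..1, s ^ 2 * ρ s := by
      rw [intervalIntegral.integral_of_le (by linarith), intervalIntegral.integral_of_le zero_le_one]
      apply setIntegral_eq_of_subset_of_forall_sdiff_eq_zero measurableSet_Ioc
        (Set.Ioc_subset_Ioc_right hr.le)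
      intro s hs
      rw [ρgt s, mul_zero]
      by_contra! hle
      exact hs.2 ⟨hs.1.1, hle⟩
    unfold U
    rw [z1, z2, mul_zero, sub_zero]
    have : -(4 * π / r) * ∫ s in (0:ℝ)..1, s ^ 2 * ρ s
        = -(1 / r) * (4 * π * (∫ s in (0:ℝ)..1, s ^ 2 * ρ s)) := by ring
    rw [this, mass, mul_one]
  refine ⟨B / (A ^ n * LE.cint k), by positivity, ρ, ⟨?_, ?_, ?_, ρgt, mass⟩, ?_, ?_⟩
  · rw [hρ]
    exact Measurable.ite measurableSet_Iic (by fun_prop) measurable_const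
  · intro r
    rcases le_or_gt r 1 with hr | hr
    · rw [ρle r hr]; exact mul_nonneg hB0.le (h0 _)
    · rw [ρgt r hr]
  · intro r s hr hrs hs
    rw [ρle r (hrs.trans hs), ρle s hs]
    refine mul_le_mul_of_nonneg_left (hanti _ _ (by positivity) ?_ ?_) hB0.le
    · gcongr
    · nlinarith
  · refine Filter.Eventually.of_forall fun x hx hx1 => ?_
    have hRr : R * ‖x‖ ≤ R := by nlinarith
    have hRr0 : 0 ≤ R * ‖x‖ := by positivity
    have ec : ∀ v : EuclideanSpace ℝ (Fin 3), -1 - ‖v‖ ^ 2 / 2 - U ρ ‖x‖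
        = A * y (R * ‖x‖) - ‖v‖ ^ 2 / 2 := by
      intro v; rw [← pot _ hx hx1]; ring
    simp_rw [ec]
    rw [integral_const_mul, ρle _ hx1, hpow _ hRr0 hRr]
    rcases eq_or_lt_of_le (ynn _ hRr0 hRr) with hz | hz
    · rw [← hz, LE.int_zero k (by simp), zero_rpow hn0.ne', mul_zero, mul_zero]
    · rw [LE.int_scale k (by positivity), ← hn, mul_rpow hA0.le hz.le]
      have : 0 < A ^ n := by positivity
      field_simp
  · intro x v hx
    rw [potgt _ hx, cutPow, if_neg, mul_zero]
    have : 1 / ‖x‖ < 1 := by rw [div_lt_one (by linarith)]; exact hx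
    nlinarith [sq_nonneg ‖v‖]
end
end
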